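/- arXiv:1610.06005 — 2 statements merged into one kernel-verified Lean document; each statement's English description precedes it below -/
import Mathlib

section
/- Let n ≥ 2 and let T : ℝ^n → ℝ^m be a linear map. For each self-similar proper n-system P, the point μ_T(P) belongs to the connected component of the point n^{-1}T(1, …, 1) in the set {μ_T(Q) : Q a proper n-system}. -/
open Filter Set Pointwise Topology

noncomputable section

/-- Points of `ℝ^n`. -/
abbrev RVec (n : ℕ) := Fin n → ℝ

/-- The vector of `ℝ^n` with a `1` in position `j` (0-based) and `0` elsewhere;
`eVec n 0` is the first canonical basis vector `e_1`. -/
def eVec (n : ℕ) (j : ℕ) : RVec n := fun i => if (i : ℕ) = j then 1 else 0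

/-- `P` is an `n`-system on the subinterval `I` of `[0,∞)`:
`I` is an order-connected subset of `[0,∞)` with nonempty interior, and conditions
(S1), (S2), (S3) hold at every `q ∈ I`. -/
def IsNSystem (n : ℕ) (I : Set ℝ) (P : ℝ → RVec n) : Prop :=
  I ⊆ Set.Ici (0 : ℝ) ∧ I.OrdConnected ∧ (interior I).Nonempty ∧
  ∀ q ∈ I,
    ((∀ i, 0 ≤ P q i) ∧ Monotone (P q) ∧ (∑ i, P q i) = q) ∧
    ∃ ε > (0 : ℝ), ∃ k ℓ : Fin n,
      (∀ t ∈ I ∩ Set.Icc (q - ε) q, P t = P q + (t - q) • eVec n ℓ) ∧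
      (∀ t ∈ I ∩ Set.Icc q (q + ε), P t = P q + (t - q) • eVec n k) ∧
      (q ∈ interior I → ℓ < k → ∀ i : Fin n, ℓ ≤ i → i ≤ k → P q i = P q ℓ)

/-- `P` is a proper `n`-system on `I`: it is an `n`-system whose first component is
unbounded (by the monotonicity (S1) of the components, this is equivalent to all
components simultaneously exceeding any given bound). -/
def IsProperSys (n : ℕ) (I : Set ℝ) (P : ℝ → RVec n) : Prop :=
  IsNSystem n I P ∧ ∀ M : ℝ, ∃ q ∈ I, ∀ i, M < P q i

/-- The set `F(P)` of limits of `q_i⁻¹ • P(q_i)` along strictly increasing unbounded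
sequences `(q_i)` in `I`. -/
def FSet (n : ℕ) (I : Set ℝ) (P : ℝ → RVec n) : Set (RVec n) :=
  {x | ∃ q : ℕ → ℝ, (∀ i, q i ∈ I) ∧ StrictMono q ∧
    Tendsto q atTop atTop ∧ Tendsto (fun i => (q i)⁻¹ • P (q i)) atTop (𝓝 x)}

/-- The set `F(P, e₁)`: as `F(P)`, but with the extra requirement that the right
derivative of `P` at each `q_i` is the first basis vector `e_1`. -/
def FSetE1 (n : ℕ) (I : Set ℝ) (P : ℝ → RVec n) : Set (RVec n) :=
  {x | ∃ q : ℕ → ℝ, (∀ i, q i ∈ I) ∧ StrictMono q ∧ Tendsto q atTop atTop ∧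
    (∀ i, ∃ ε > (0 : ℝ), ∀ t ∈ I ∩ Set.Icc (q i) (q i + ε),
      P t = P (q i) + (t - q i) • eVec n 0) ∧
    Tendsto (fun i => (q i)⁻¹ • P (q i)) atTop (𝓝 x)}

/-- `q` is a switch number of the `n`-system `P` on `I`: a point of `I` on the boundary
of `I`, or an interior point where the local slopes `e_k` (right) and `e_ℓ` (left)
from (S2) satisfy `k < ℓ`. -/
def IsSwitchNumber (n : ℕ) (I : Set ℝ) (P : ℝ → RVec n) (q : ℝ) : Prop :=
  q ∈ I ∧ (q ∈ frontier I ∨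
    (q ∈ interior I ∧ ∃ ε > (0 : ℝ), ∃ k ℓ : Fin n, k < ℓ ∧
      (∀ t ∈ I ∩ Set.Icc (q - ε) q, P t = P q + (t - q) • eVec n ℓ) ∧
      (∀ t ∈ I ∩ Set.Icc q (q + ε), P t = P q + (t - q) • eVec n k)))

/-- `q` is a division number of the `n`-system `P` on `I`: a point of `I` on the boundary
of `I`, or an interior point where `P` is not differentiable, i.e. where the left and
right slopes from (S2) differ. -/
def IsDivisionNumber (n : ℕ) (I : Set ℝ) (P : ℝ → RVec n) (q : ℝ) : Prop :=
  q ∈ I ∧ (q ∈ frontier I ∨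
    (q ∈ interior I ∧ ∃ ε > (0 : ℝ), ∃ k ℓ : Fin n, k ≠ ℓ ∧
      (∀ t ∈ I ∩ Set.Icc (q - ε) q, P t = P q + (t - q) • eVec n ℓ) ∧
      (∀ t ∈ I ∩ Set.Icc q (q + ε), P t = P q + (t - q) • eVec n k)))

/-- A non-degenerate `n`-system: an `n`-system whose domain is a closed subinterval
of `(0,∞)` and whose switch points all have `n` distinct positive coordinates. -/
def IsNonDegenerate (n : ℕ) (I : Set ℝ) (P : ℝ → RVec n) : Prop :=
  IsNSystem n I P ∧ IsClosed I ∧ I ⊆ Set.Ioi (0 : ℝ) ∧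
  ∀ q, IsSwitchNumber n I P q → (∀ i, 0 < P q i) ∧ StrictMono (P q)

/-- A rigid `n`-system of mesh `δ`: a non-degenerate `n`-system whose switch points
belong to `δℤ^n`. -/
def IsRigid (n : ℕ) (δ : ℝ) (I : Set ℝ) (P : ℝ → RVec n) : Prop :=
  IsNonDegenerate n I P ∧
  ∀ q, IsSwitchNumber n I P q → ∀ i, ∃ m : ℤ, P q i = δ * m

/-- A self-similar system: the domain is unbounded and there is `ρ > 1` with
`P(ρq) = ρ • P(q)` for all `q` in the domain. -/
def IsSelfSimilar (n : ℕ) (I : Set ℝ) (P : ℝ → RVec n) : Prop :=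
  ¬ BddAbove I ∧ ∃ ρ : ℝ, 1 < ρ ∧ ∀ q ∈ I, ρ * q ∈ I ∧ P (ρ * q) = ρ • P q

/-- The cube `[-ε, ε]^n`. -/
def cubeNbhd (n : ℕ) (ε : ℝ) : Set (RVec n) := {y | ∀ i, |y i| ≤ ε}

/-- The distance `dist(E, F)`: the infimum of all `ε > 0` such that
`E ⊆ F + [-ε,ε]^n` and `F ⊆ E + [-ε,ε]^n`. -/
def cubeDist (n : ℕ) (E F : Set (RVec n)) : ℝ :=
  sInf {ε : ℝ | 0 < ε ∧ E ⊆ F + cubeNbhd n ε ∧ F ⊆ E + cubeNbhd n ε}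

/-- `μ_T(P)`: the point of `ℝ^m` whose `j`-th coordinate is
`liminf_{q → ∞, q ∈ I} T_j(P(q))/q`. -/
def muT (n m : ℕ) (T : RVec n → RVec m) (I : Set ℝ) (P : ℝ → RVec n) : RVec m :=
  fun j => Filter.liminf (fun q => T (P q) j / q) (atTop ⊓ 𝓟 I)

/-- `liminf` of a sequence of subsets of `ℝ^n`: the set of limits of convergent
sequences `(x_i)` with `x_i ∈ F i` for every `i`. -/
def setLiminf (n : ℕ) (F : ℕ → Set (RVec n)) : Set (RVec n) :=
  {x | ∃ y : ℕ → RVec n, (∀ i, y i ∈ F i) ∧ Tendsto y atTop (𝓝 x)}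

/-- `limsup` of a sequence of subsets of `ℝ^n`: the set of accumulation points of
sequences `(x_i)` with `x_i ∈ F i` for every `i`, i.e. limits of convergent
subsequences. -/
def setLimsup (n : ℕ) (F : ℕ → Set (RVec n)) : Set (RVec n) :=
  {x | ∃ (y : ℕ → RVec n) (φ : ℕ → ℕ), (∀ i, y i ∈ F i) ∧ StrictMono φ ∧
    Tendsto (y ∘ φ) atTop (𝓝 x)}
theorem eVec_nonneg (n j : ℕ) (i : Fin n) : 0 ≤ eVec n j i := by
  unfold eVec; split_ifs <;> norm_num

theorem eVec_le_one (n j : ℕ) (i : Fin n) : eVec n j i ≤ 1 := by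
  unfold eVec; split_ifs <;> norm_num

namespace IsNSystem

variable {n : ℕ} {I : Set ℝ} {P : ℝ → RVec n}

theorem continuousOn_apply (h : IsNSystem n I P) (i : Fin n) :
    ContinuousOn (fun q => P q i) I := by
  rw [Metric.continuousOn_iff]
  intro q hq ε hε
  obtain ⟨_, δ, hδ, k, l, hl, hk, _⟩ := h.2.2.2 q hq
  refine ⟨min δ ε, lt_min hδ hε, fun t ht htq => ?_⟩
  rw [Real.dist_eq] at htq ⊢
  have h1 := htq.trans_le (min_le_left _ _)
  have h2 := htq.trans_le (min_le_right _ _)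
  have key : ∃ j : Fin n, P t = P q + (t - q) • eVec n j := by
    rw [abs_lt] at h1
    rcases le_total t q with htq' | htq'
    · exact ⟨l, hl t ⟨ht, by linarith, htq'⟩⟩
    · exact ⟨k, hk t ⟨ht, htq', by linarith⟩⟩
  obtain ⟨j, hj⟩ := key
  simp only [hj, Pi.add_apply, Pi.smul_apply, smul_eq_mul, add_sub_cancel_left, abs_mul]
  rw [abs_of_nonneg (eVec_nonneg n j i)]
  exact (mul_le_of_le_one_right (abs_nonneg _) (eVec_le_one n j i)).trans_lt h2

theorem monotoneOn_apply (h : IsNSystem n I P) (i : Fin n) :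
    MonotoneOn (fun q => P q i) I := by
  intro a ha b hb hab
  have hI : Icc a b ⊆ I := h.2.1.out ha hb
  have hder : ∀ x, ∃ c : ℝ, 0 ≤ c ∧
      (x ∈ Ico a b → HasDerivWithinAt (fun q => P q i) c (Ici x) x) := by
    intro x
    by_cases hx : x ∈ Ico a b
    · obtain ⟨_, δ, hδ, k, l, -, hk, _⟩ := h.2.2.2 x (hI (Ico_subset_Icc_self hx))
      refine ⟨eVec n k i, eVec_nonneg n k i, fun _ => ?_⟩
      have hlin : HasDerivWithinAt (fun t => P x i + (t - x) * eVec n k i) (eVec n k i)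
          (Ici x) x := by
        have := (((hasDerivAt_id x).sub_const x).mul_const (eVec n k i)).const_add (P x i)
        simpa using this.hasDerivWithinAt
      refine hlin.congr_of_eventuallyEq ?_ (by simp)
      have hlt : x < min b (x + δ) := lt_min hx.2 (by linarith)
      filter_upwards [Icc_mem_nhdsGE hlt] with t ht
      have := hk t ⟨hI ⟨hx.1.trans ht.1, ht.2.trans (min_le_left _ _)⟩, ht.1,
        ht.2.trans (min_le_right _ _)⟩
      simp [this]
    · exact ⟨0, le_rfl, fun hx' => absurd hx' hx⟩
  choose d hd0 hd using hder
  exact image_le_of_deriv_right_le_deriv_boundary (f := fun _ => P a i) (f' := fun _ => 0)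
    continuousOn_const (fun x _ => hasDerivWithinAt_const _ _ _) le_rfl
    ((h.continuousOn_apply i).mono hI) (fun x hx => hd x hx) (fun x _ => hd0 x)
    (right_mem_Icc.2 hab)

theorem nonneg (h : IsNSystem n I P) {q : ℝ} (hq : q ∈ I) (i : Fin n) : 0 ≤ P q i :=
  (h.2.2.2 q hq).1.1 i

theorem sum_eq (h : IsNSystem n I P) {q : ℝ} (hq : q ∈ I) : ∑ i, P q i = q :=
  (h.2.2.2 q hq).1.2.2

theorem le_self (h : IsNSystem n I P) {q : ℝ} (hq : q ∈ I) (i : Fin n) : P q i ≤ q := by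
  conv_rhs => rw [← h.sum_eq hq]
  exact Finset.single_le_sum (fun j _ => h.nonneg hq j) (Finset.mem_univ i)

end IsNSystem

/-- The new parameter attached to `q` when a function `f` is applied to all the components
of the system `P`. -/
def warpTime (n : ℕ) (f : ℝ → ℝ) (P : ℝ → RVec n) (q : ℝ) : ℝ := ∑ i, f (P q i)

/-- The system obtained from `P` by applying `f` to all its components, parametrized by the
sum of its components. -/
def warpSystem (n : ℕ) (f : ℝ → ℝ) (I : Set ℝ) (P : ℝ → RVec n) (s : ℝ) : RVec n :=
  fun i => f (P (Function.invFunOn (warpTime n f P) I s) i)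

section Warp

variable {n : ℕ} {I : Set ℝ} {P : ℝ → RVec n} {f : ℝ → ℝ}

theorem IsNSystem.strictMonoOn_warpTime (h : IsNSystem n I P) (hf : StrictMonoOn f (Ici 0)) :
    StrictMonoOn (warpTime n f P) I := by
  intro a ha b hb hab
  have hmono : ∀ i, P a i ≤ P b i := fun i => h.monotoneOn_apply i ha hb hab.le
  have hlt : ∃ i ∈ Finset.univ, P a i < P b i := by
    apply Finset.exists_lt_of_sum_lt
    rwa [h.sum_eq ha, h.sum_eq hb]
  obtain ⟨i, hi, hlt⟩ := hlt
  exact Finset.sum_lt_sum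
    (fun j _ => hf.monotoneOn (h.nonneg ha j) (h.nonneg hb j) (hmono j))
    ⟨i, hi, hf (h.nonneg ha i) (h.nonneg hb i) hlt⟩

theorem IsNSystem.warpSystem_warpTime (h : IsNSystem n I P) (hf : StrictMonoOn f (Ici 0))
    {q : ℝ} (hq : q ∈ I) : warpSystem n f I P (warpTime n f P q) = fun i => f (P q i) := by
  have := (h.strictMonoOn_warpTime hf).injOn.leftInvOn_invFunOn hq
  unfold warpSystem
  rw [this]

/-- The image of an affine piece of `P` moving in direction `e_j`. -/
theorem warp_affine (f : ℝ → ℝ) {x y : RVec n} {c : ℝ} {j : Fin n}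
    (hxy : y = x + c • eVec n j) :
    (fun i => f (y i)) = (fun i => f (x i)) +
      (∑ i, f (y i) - ∑ i, f (x i)) • eVec n j := by
  have hne : ∀ i, i ≠ j → y i = x i := by
    intro i hi
    have : (i : ℕ) ≠ j := fun h => hi (Fin.ext h)
    simp [hxy, eVec, this]
  have hsum : ∑ i, f (y i) - ∑ i, f (x i) = f (y j) - f (x j) := by
    rw [← Finset.sum_sub_distrib]
    exact Finset.sum_eq_single j (fun i _ hi => by rw [hne i hi, sub_self]) (by simp)
  rw [hsum]
  funext i
  by_cases hi : i = j
  · subst hi; simp [eVec]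
  · have : (i : ℕ) ≠ j := fun h => hi (Fin.ext h)
    simp [eVec, this, hne i hi]

theorem IsNSystem.warp (h : IsNSystem n I P) (hf : StrictMonoOn f (Ici 0))
    (hfc : ContinuousOn f (Ici 0)) (hf0 : ∀ x, 0 ≤ x → 0 ≤ f x) :
    IsNSystem n (warpTime n f P '' I) (warpSystem n f I P) := by
  have hσ := h.strictMonoOn_warpTime hf
  have hσc : ContinuousOn (warpTime n f P) I :=
    continuousOn_finsetSum _ fun i _ =>
      hfc.comp (h.continuousOn_apply i) fun q hq => h.nonneg hq i
  have hord : (warpTime n f P '' I).OrdConnected :=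
    (h.2.1.isPreconnected.image _ hσc).ordConnected
  refine ⟨?_, hord, ?_, ?_⟩
  · rintro _ ⟨q, hq, rfl⟩
    exact Finset.sum_nonneg fun i _ => hf0 _ (h.nonneg hq i)
  · obtain ⟨a, ha⟩ := h.2.2.1
    obtain ⟨b, hab, hb⟩ := (mem_nhdsGE_iff_exists_Icc_subset.1
      (mem_nhdsWithin_of_mem_nhds (mem_interior_iff_mem_nhds.1 ha)))
    have ha' := interior_subset ha
    have hb' : b ∈ I := hb (right_mem_Icc.2 (le_of_lt hab))
    have hlt := hσ ha' hb' hab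
    refine Set.Nonempty.mono (interior_mono
      (hord.out (mem_image_of_mem _ ha') (mem_image_of_mem _ hb'))) ?_
    rw [interior_Icc]
    exact nonempty_Ioo.2 hlt
  · rintro _ ⟨q, hq, rfl⟩
    obtain ⟨⟨_, hmono, _⟩, ε, hε, k, l, hl, hk, hkl⟩ := h.2.2.2 q hq
    rw [h.warpSystem_warpTime hf hq]
    refine ⟨⟨fun i => hf0 _ (h.nonneg hq i), fun i j hij =>
      hf.monotoneOn (h.nonneg hq i) (h.nonneg hq j) (hmono hij), rfl⟩, ?_⟩
    have hleft : ∃ δ > 0, ∀ t ∈ I, t ≤ q → warpTime n f P q - δ ≤ warpTime n f P t →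
        q - ε ≤ t := by
      by_cases hmem : q - ε ∈ I
      · refine ⟨warpTime n f P q - warpTime n f P (q - ε),
          sub_pos.2 (hσ hmem hq (by linarith)), fun t ht _ hle => ?_⟩
        exact (hσ.le_iff_le hmem ht).1 (by linarith)
      · refine ⟨1, one_pos, fun t ht htq _ => ?_⟩
        by_contra! hlt
        exact hmem (h.2.1.out ht hq ⟨hlt.le, by linarith⟩)
    have hright : ∃ δ > 0, ∀ t ∈ I, q ≤ t → warpTime n f P t ≤ warpTime n f P q + δ →
        t ≤ q + ε := by
      by_cases hmem : q + ε ∈ I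
      · refine ⟨warpTime n f P (q + ε) - warpTime n f P q,
          sub_pos.2 (hσ hq hmem (by linarith)), fun t ht _ hle => ?_⟩
        exact (hσ.le_iff_le ht hmem).1 (by linarith)
      · refine ⟨1, one_pos, fun t ht htq _ => ?_⟩
        by_contra! hlt
        exact hmem (h.2.1.out hq ht ⟨by linarith, hlt.le⟩)
    obtain ⟨δ₁, hδ₁, hleft⟩ := hleft
    obtain ⟨δ₂, hδ₂, hright⟩ := hright
    refine ⟨min δ₁ δ₂, lt_min hδ₁ hδ₂, k, l, ?_, ?_, ?_⟩
    · rintro _ ⟨⟨t, ht, rfl⟩, h1, h2⟩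
      have htq : t ≤ q := (hσ.le_iff_le ht hq).1 h2
      have := min_le_left δ₁ δ₂
      rw [h.warpSystem_warpTime hf ht]
      exact warp_affine f (hl t ⟨ht, hleft t ht htq (by linarith), htq⟩)
    · rintro _ ⟨⟨t, ht, rfl⟩, h1, h2⟩
      have htq : q ≤ t := (hσ.le_iff_le hq ht).1 h1
      have := min_le_right δ₁ δ₂
      rw [h.warpSystem_warpTime hf ht]
      exact warp_affine f (hk t ⟨ht, htq, hright t ht htq (by linarith)⟩)
    · intro hint hlk i hli hik
      have hqint : q ∈ interior I := by
        obtain ⟨u, v, huv, hsub⟩ := mem_nhds_iff_exists_Ioo_subset.1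
          (mem_interior_iff_mem_nhds.1 hint)
        obtain ⟨a, ha, haeq⟩ : (u + warpTime n f P q) / 2 ∈ warpTime n f P '' I :=
          hsub ⟨by linarith [huv.1], by linarith [huv.1, huv.2]⟩
        obtain ⟨b, hb, hbeq⟩ : (v + warpTime n f P q) / 2 ∈ warpTime n f P '' I :=
          hsub ⟨by linarith [huv.1, huv.2], by linarith [huv.2]⟩
        have haq : a < q := (hσ.lt_iff_lt ha hq).1 (by rw [haeq]; linarith [huv.1])
        have hqb : q < b := (hσ.lt_iff_lt hq hb).1 (by rw [hbeq]; linarith [huv.2])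
        exact mem_interior_iff_mem_nhds.2
          (mem_of_superset (Icc_mem_nhds haq hqb) (h.2.1.out ha hb))
      simp only [hkl hqint hlk i hli hik]

theorem IsProperSys.warp (h : IsProperSys n I P) (hf : StrictMonoOn f (Ici 0))
    (hfc : ContinuousOn f (Ici 0)) (hf0 : ∀ x, 0 ≤ x → 0 ≤ f x)
    (hftop : Tendsto f atTop atTop) :
    IsProperSys n (warpTime n f P '' I) (warpSystem n f I P) := by
  refine ⟨h.1.warp hf hfc hf0, fun M => ?_⟩
  obtain ⟨K, hK⟩ := (hftop.eventually_gt_atTop M).exists_forall_of_atTop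
  obtain ⟨q, hq, hqK⟩ := h.2 K
  refine ⟨_, mem_image_of_mem _ hq, fun i => ?_⟩
  rw [h.1.warpSystem_warpTime hf hq]
  exact hK _ (hqK i).le

theorem IsProperSys.neBot (h : IsProperSys n I P) (hn : 0 < n) : (atTop ⊓ 𝓟 I).NeBot := by
  rw [inf_principal_neBot_iff]
  intro U hU
  obtain ⟨K, hK⟩ := mem_atTop_sets.1 hU
  obtain ⟨q, hq, hqK⟩ := h.2 K
  exact ⟨q, hK q ((hqK ⟨0, hn⟩).le.trans (h.1.le_self hq _)), hq⟩

theorem IsProperSys.tendsto_apply (h : IsProperSys n I P) (i : Fin n) :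
    Tendsto (fun q => P q i) (atTop ⊓ 𝓟 I) atTop := by
  rw [tendsto_atTop]
  intro M
  obtain ⟨q₀, hq₀, hM⟩ := h.2 M
  filter_upwards [inter_mem_inf (Ici_mem_atTop q₀) (mem_principal_self I)] with q hq
  exact (hM i).le.trans (h.1.monotoneOn_apply i hq₀ hq.2 hq.1)

theorem IsProperSys.map_warpTime (h : IsProperSys n I P) (hn : 0 < n)
    (hf : StrictMonoOn f (Ici 0)) (hf0 : ∀ x, 0 ≤ x → 0 ≤ f x)
    (hftop : Tendsto f atTop atTop) :
    map (warpTime n f P) (atTop ⊓ 𝓟 I) = atTop ⊓ 𝓟 (warpTime n f P '' I) := by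
  have hσ := h.1.strictMonoOn_warpTime hf
  apply le_antisymm
  · refine le_inf ?_ (le_principal_iff.2 (mem_map.2 (mem_of_superset
      (mem_inf_of_right (mem_principal_self I)) (subset_preimage_image _ _))))
    refine tendsto_atTop_mono' _ ?_ (hftop.comp (h.tendsto_apply ⟨0, hn⟩))
    filter_upwards [mem_inf_of_right (mem_principal_self I)] with q hq
    exact Finset.single_le_sum (f := fun i => f (P q i))
      (fun j _ => hf0 _ (h.1.nonneg hq j)) (Finset.mem_univ _)
  · intro U hU
    obtain ⟨K, hK⟩ := mem_atTop_sets.1 (mem_inf_principal.1 (mem_map.1 hU))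
    obtain ⟨q₀, hq₀, hlt⟩ := h.2 K
    have hK₀ : K ≤ q₀ := (hlt ⟨0, hn⟩).le.trans (h.1.le_self hq₀ _)
    refine mem_inf_principal.2 (mem_atTop_sets.2 ⟨warpTime n f P q₀, ?_⟩)
    rintro _ hle ⟨q, hq, rfl⟩
    exact hK q (hK₀.trans ((hσ.le_iff_le hq₀ hq).1 hle)) hq

theorem IsProperSys.muT_warp (h : IsProperSys n I P) (hn : 0 < n)
    (hf : StrictMonoOn f (Ici 0)) (hf0 : ∀ x, 0 ≤ x → 0 ≤ f x)
    (hftop : Tendsto f atTop atTop) {m : ℕ} {T : RVec n → RVec m} (hT : IsLinearMap ℝ T) :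
    muT n m T (warpTime n f P '' I) (warpSystem n f I P) = fun j =>
      liminf (fun q => T ((∑ i, f (P q i))⁻¹ • fun i => f (P q i)) j) (atTop ⊓ 𝓟 I) := by
  funext j
  unfold muT
  rw [← h.map_warpTime hn hf hf0 hftop]
  refine liminf_congr (f := atTop ⊓ 𝓟 I) ?_
  filter_upwards [mem_inf_of_right (mem_principal_self I)] with q hq
  simp only [h.1.warpSystem_warpTime hf hq, hT.map_smul, Pi.smul_apply, smul_eq_mul, div_eq_inv_mul]
  rfl

end Warp

/-- The normalized `α`-th power of a vector with positive coordinates. -/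
def powNormalize (n : ℕ) (α : ℝ) (x : RVec n) : RVec n :=
  (∑ i, x i ^ α)⁻¹ • fun i => x i ^ α

theorem continuousOn_powNormalize {n : ℕ} (hn : 0 < n) :
    ContinuousOn (fun p : ℝ × RVec n => powNormalize n p.1 p.2) {p | ∀ i, 0 < p.2 i} := by
  have hpow : ∀ i, ContinuousOn (fun p : ℝ × RVec n => p.2 i ^ p.1) {p | ∀ i, 0 < p.2 i} :=
    fun i => ContinuousOn.rpow (by fun_prop) (by fun_prop) fun p hp => Or.inl (hp i).ne'
  refine ContinuousOn.smul (ContinuousOn.inv₀ (continuousOn_finsetSum _ fun i _ => hpow i) ?_)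
    (continuousOn_pi.2 hpow)
  intro p hp
  have : Nonempty (Fin n) := ⟨⟨0, hn⟩⟩
  exact (Finset.sum_pos (fun i _ => Real.rpow_pos_of_pos (hp i) _) Finset.univ_nonempty).ne'

theorem powNormalize_smul {n : ℕ} {α c : ℝ} (hc : 0 < c) {x : RVec n} (hx : ∀ i, 0 ≤ x i) :
    powNormalize n α (c • x) = powNormalize n α x := by
  have hpow : ∀ i, (c * x i) ^ α = c ^ α * x i ^ α := fun i => Real.mul_rpow hc.le (hx i)
  have hcα : c ^ α ≠ 0 := (Real.rpow_pos_of_pos hc α).ne'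
  funext i
  simp only [powNormalize, Pi.smul_apply, smul_eq_mul, hpow, ← Finset.mul_sum, mul_inv]
  field_simp

/-- Self-similarity bounds `P_1(q)/q` away from zero. -/
theorem IsProperSys.exists_mul_le {n : ℕ} {I : Set ℝ} {P : ℝ → RVec n}
    (h : IsProperSys n I P) (hn : 0 < n) (hss : IsSelfSimilar n I P) :
    ∃ c > 0, ∀ᶠ q in atTop ⊓ 𝓟 I, 0 < q ∧ q ∈ I ∧ ∀ i, c * q ≤ P q i := by
  obtain ⟨-, ρ, hρ, hself⟩ := hss
  obtain ⟨q₀, hq₀, hone⟩ := h.2 1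
  have hq₀pos : 0 < q₀ :=
    one_pos.trans ((hone ⟨0, hn⟩).trans_le (h.1.le_self hq₀ _))
  have hρ0 : 0 < ρ := one_pos.trans hρ
  have hiter : ∀ k : ℕ, ρ ^ k * q₀ ∈ I ∧ P (ρ ^ k * q₀) = ρ ^ k • P q₀ := by
    intro k
    induction k with
    | zero => simpa using hq₀
    | succ k ih =>
      have := hself _ ih.1
      rw [ih.2, ← mul_assoc, ← pow_succ', smul_smul, ← pow_succ'] at this
      exact this
  refine ⟨(ρ * q₀)⁻¹, by positivity, ?_⟩
  filter_upwards [inter_mem_inf (Ici_mem_atTop q₀) (mem_principal_self I)] with q hq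
  refine ⟨hq₀pos.trans_le hq.1, hq.2, fun i => ?_⟩
  obtain ⟨k, hk1, hk2⟩ := exists_nat_pow_near ((one_le_div hq₀pos).2 hq.1) hρ
  rw [le_div_iff₀ hq₀pos] at hk1
  rw [div_lt_iff₀ hq₀pos] at hk2
  have hP := h.1.monotoneOn_apply i (hiter k).1 hq.2 hk1
  simp only [(hiter k).2, Pi.smul_apply, smul_eq_mul] at hP
  calc (ρ * q₀)⁻¹ * q ≤ (ρ * q₀)⁻¹ * (ρ ^ (k + 1) * q₀) := by gcongr
    _ = ρ ^ k := by field_simp; ring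
    _ ≤ ρ ^ k * P q₀ i := le_mul_of_one_le_right (by positivity) (hone i).le
    _ ≤ P q i := hP

/-- The lower limit of a jointly continuous function along a filter on a compact set depends
continuously on the parameter. -/
theorem continuousOn_liminf_of_compact {X Y ι : Type*} [PseudoMetricSpace X]
    [PseudoMetricSpace Y] {A : Set X} {K : Set Y} (hA : IsCompact A) (hK : IsCompact K)
    {Φ : X × Y → ℝ} (hΦ : ContinuousOn Φ (A ×ˢ K)) {F : Filter ι} [F.NeBot] {x : ι → Y}
    (hx : ∀ᶠ q in F, x q ∈ K) :
    ContinuousOn (fun a => liminf (fun q => Φ (a, x q)) F) A := by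
  obtain ⟨C, hC⟩ := (hA.prod hK).exists_bound_of_continuousOn hΦ
  have hle : ∀ a ∈ A, F.IsBoundedUnder (· ≤ ·) fun q => Φ (a, x q) := fun a ha =>
    isBoundedUnder_of_eventually_le (a := C) (hx.mono fun q hq =>
      (abs_le.1 (hC (a, x q) ⟨ha, hq⟩)).2)
  have hge : ∀ a ∈ A, F.IsBoundedUnder (· ≥ ·) fun q => Φ (a, x q) := fun a ha =>
    isBoundedUnder_of_eventually_ge (a := -C) (hx.mono fun q hq =>
      (abs_le.1 (hC (a, x q) ⟨ha, hq⟩)).1)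
  have huc := Metric.uniformContinuousOn_iff.1
    ((hA.prod hK).uniformContinuousOn_of_continuous hΦ)
  rw [Metric.continuousOn_iff]
  intro a ha ε hε
  obtain ⟨δ, hδ, hclose⟩ := huc (ε / 2) (half_pos hε)
  refine ⟨δ, hδ, fun b hb hba => ?_⟩
  have hineq : ∀ u ∈ A, ∀ v ∈ A, dist u v < δ →
      liminf (fun q => Φ (u, x q)) F ≤ liminf (fun q => Φ (v, x q)) F + ε / 2 := by
    intro u hu v hv huv
    rw [← liminf_add_const F _ _ (hle v hv).isCoboundedUnder_ge (hge v hv)]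
    refine liminf_le_liminf ?_ (hge u hu) ?_
    · filter_upwards [hx] with q hq
      have := hclose (u, x q) ⟨hu, hq⟩ (v, x q) ⟨hv, hq⟩ (by
        rw [Prod.dist_eq, dist_self]; exact max_lt huv hδ)
      rw [Real.dist_eq] at this
      linarith [(abs_lt.1 this).2]
    · refine IsBoundedUnder.isCoboundedUnder_ge (isBoundedUnder_of_eventually_le
        (a := C + ε / 2) (hx.mono fun q hq => ?_))
      linarith [(abs_le.1 (hC (v, x q) ⟨hv, hq⟩)).2]
  have h1 := hineq b hb a ha hba
  have h2 := hineq a ha b hb (by rwa [dist_comm])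
  rw [Real.dist_eq, abs_lt]
  constructor <;> linarith

/-- The barycentre `n⁻¹ T(1,…,1)` is attained, by a logarithmic deformation of a proper system
whose first component grows linearly. -/
theorem IsProperSys.barycentre_mem {n m : ℕ} {I : Set ℝ} {P : ℝ → RVec n}
    (h : IsProperSys n I P) (hn : 0 < n) {c : ℝ} (hc : 0 < c)
    (hlow : ∀ᶠ q in atTop ⊓ 𝓟 I, 0 < q ∧ q ∈ I ∧ ∀ i, c * q ≤ P q i)
    {T : RVec n → RVec m} (hT : IsLinearMap ℝ T) :
    ∃ J Q, IsProperSys n J Q ∧ muT n m T J Q = (n : ℝ)⁻¹ • T (fun _ => 1) := by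
  set f : ℝ → ℝ := fun x => Real.log (1 + x) with hfdef
  have hf : StrictMonoOn f (Ici 0) := fun x hx y _ hxy =>
    Real.log_lt_log (by linarith [mem_Ici.1 hx]) (by linarith)
  have hfc : ContinuousOn f (Ici 0) :=
    ContinuousOn.log (by fun_prop) fun x hx => by linarith [mem_Ici.1 hx]
  have hf0 : ∀ x, 0 ≤ x → 0 ≤ f x := fun x hx => Real.log_nonneg (by linarith)
  have hftop : Tendsto f atTop atTop :=
    Real.tendsto_log_atTop.comp (tendsto_atTop_add_const_left _ _ tendsto_id)
  refine ⟨_, _, h.warp hf hfc hf0 hftop, ?_⟩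
  rw [h.muT_warp hn hf hf0 hftop hT]
  have := h.neBot hn
  have hq : Tendsto (fun q : ℝ => q) (atTop ⊓ 𝓟 I) atTop := tendsto_inf_left tendsto_id
  have hfq : Tendsto f (atTop ⊓ 𝓟 I) atTop := hftop.comp hq
  have hratio : ∀ i, Tendsto (fun q => f (P q i) / f q) (atTop ⊓ 𝓟 I) (𝓝 1) := by
    intro i
    have hlim : Tendsto (fun q => 1 + Real.log (min c 1) / f q) (atTop ⊓ 𝓟 I) (𝓝 1) := by
      simpa using (hfq.const_div_atTop (Real.log (min c 1))).const_add 1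
    refine tendsto_of_tendsto_of_tendsto_of_le_of_le' hlim tendsto_const_nhds ?_ ?_
    · filter_upwards [hlow, hfq.eventually_gt_atTop 0] with q hq hfpos
      have hmin : 0 < min c 1 := lt_min hc one_pos
      rw [le_div_iff₀ hfpos, add_mul, div_mul_cancel₀ _ hfpos.ne', one_mul, add_comm, hfdef]
      simp only
      rw [← Real.log_mul hmin.ne' (by linarith)]
      refine Real.log_le_log (mul_pos hmin (by linarith)) ?_
      have h1 : min c 1 * q ≤ c * q := mul_le_mul_of_nonneg_right (min_le_left _ _) hq.1.le
      linarith [min_le_right c 1, hq.2.2 i]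
    · filter_upwards [hlow, hfq.eventually_gt_atTop 0] with q hq hfpos
      exact (div_le_one hfpos).2 (hf.monotoneOn (h.1.nonneg hq.2.1 i) hq.1.le
        (h.1.le_self hq.2.1 i))
  have hn' : (n : ℝ) ≠ 0 := by exact_mod_cast hn.ne'
  have hvec : Tendsto (fun q => (∑ i, f (P q i))⁻¹ • fun i => f (P q i)) (atTop ⊓ 𝓟 I)
      (𝓝 ((n : ℝ)⁻¹ • fun _ : Fin n => (1 : ℝ))) := by
    have hsum : Tendsto (fun q => ∑ i, f (P q i) / f q) (atTop ⊓ 𝓟 I) (𝓝 (n : ℝ)) := by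
      simpa using tendsto_finsetSum Finset.univ fun i _ => hratio i
    refine ((hsum.inv₀ hn').smul (tendsto_pi_nhds.2 hratio)).congr' ?_
    filter_upwards [hfq.eventually_gt_atTop 0] with q hfpos
    funext i
    simp only [← Finset.sum_div, Pi.smul_apply, smul_eq_mul, inv_div]
    field_simp
  have hTc : Continuous T := (hT.mk' T).continuous_of_finiteDimensional
  funext j
  have := ((continuous_apply j).comp hTc).continuousAt.tendsto.comp hvec
  rw [← hT.map_smul]
  exact this.liminf_eq

/-- **Corollary (self-similar points lie in one component).** For a linear map
`T : ℝ^n → ℝ^m` and a self-similar proper `n`-system `P`, the point `μ_T(P)` belongs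
to the connected component of `n⁻¹ T(1,…,1)` in the spectrum
`{μ_T(Q) : Q a proper n-system}`. -/
theorem muT_mem_connectedComponentIn (n m : ℕ) (hn : 2 ≤ n)
    (T : RVec n → RVec m) (hT : IsLinearMap ℝ T)
    (I : Set ℝ) (P : ℝ → RVec n) (hP : IsProperSys n I P)
    (hss : IsSelfSimilar n I P) :
    muT n m T I P ∈ connectedComponentIn
      {y : RVec m | ∃ J Q, IsProperSys n J Q ∧ muT n m T J Q = y}
      ((n : ℝ)⁻¹ • T (fun _ => 1)) := by
  have hn0 : 0 < n := by omega
  obtain ⟨c, hc, hlow⟩ := hP.exists_mul_le hn0 hss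
  have := hP.neBot hn0
  have hTc : Continuous T := (hT.mk' T).continuous_of_finiteDimensional
  set K : Set (RVec n) := Icc (fun _ => c) (fun _ => 1)
  have hmem : ∀ᶠ q in atTop ⊓ 𝓟 I, q⁻¹ • P q ∈ K := by
    filter_upwards [hlow] with q ⟨hq0, hqI, hq⟩
    refine ⟨fun i => ?_, fun i => ?_⟩
    · simpa [← div_eq_inv_mul, le_div_iff₀ hq0] using hq i
    · simpa [← div_eq_inv_mul, div_le_one hq0] using hP.1.le_self hqI i
  set γ : ℝ → RVec m := fun α j =>
    liminf (fun q => T (powNormalize n α (q⁻¹ • P q)) j) (atTop ⊓ 𝓟 I) with hγ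
  have hγc : ContinuousOn γ (Icc 0 1) := by
    refine continuousOn_pi.2 fun j => continuousOn_liminf_of_compact
      (Φ := fun p => T (powNormalize n p.1 p.2) j) isCompact_Icc
      (isCompact_Icc (a := fun _ => c)) ?_ hmem
    exact ((continuous_apply j).comp hTc).comp_continuousOn
      ((continuousOn_powNormalize hn0).mono fun p hp i => hc.trans_le (hp.2.1 i))
  have hγeq : ∀ α, γ α = fun j =>
      liminf (fun q => T (powNormalize n α (P q)) j) (atTop ⊓ 𝓟 I) := by
    intro α
    funext j
    refine liminf_congr ?_
    filter_upwards [hlow] with q ⟨hq0, hqI, _⟩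
    rw [powNormalize_smul (inv_pos.2 hq0) (hP.1.nonneg hqI)]
  have hγ0 : γ 0 = (n : ℝ)⁻¹ • T (fun _ => 1) := by
    rw [← hT.map_smul]
    funext j
    simp [hγ, powNormalize]
  have hγ1 : γ 1 = muT n m T I P := by
    rw [hγeq]
    funext j
    refine liminf_congr ?_
    filter_upwards [hlow] with q ⟨_, hqI, _⟩
    simp only [powNormalize, Real.rpow_one, hP.1.sum_eq hqI, hT.map_smul, Pi.smul_apply,
      smul_eq_mul, div_eq_inv_mul]
  rw [← hγ0, ← hγ1]
  refine (isPreconnected_Icc.image γ hγc).subset_connectedComponentIn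
    (mem_image_of_mem γ (left_mem_Icc.2 zero_le_one)) ?_
    (mem_image_of_mem γ (right_mem_Icc.2 zero_le_one))
  rintro _ ⟨α, hα, rfl⟩
  rcases hα.1.eq_or_lt with rfl | hpos
  · rw [hγ0]
    exact hP.barycentre_mem hn0 hc hlow hT
  · have hf := Real.strictMonoOn_rpow_Ici_of_exponent_pos hpos
    have hf0 : ∀ x : ℝ, 0 ≤ x → 0 ≤ x ^ α := fun x hx => Real.rpow_nonneg hx α
    have hftop := tendsto_rpow_atTop hpos
    refine ⟨_, _, hP.warp hf (Real.continuous_rpow_const hpos.le).continuousOn hf0 hftop, ?_⟩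
    rw [hP.muT_warp hn0 hf hf0 hftop hT, hγeq]
    rfl
end
end

section
/- Let S^(1) and S^(2) be non-degenerate self-similar 3-systems. Let F = F(S^(1)) ∪ F(S^(2)) and let K denote the convex hull of F. Then there exists a non-degenerate self-similar 3-system S with F ⊆ F(S) ⊆ K; in particular K(S) = K. -/
open Filter Set Pointwise Topology

noncomputable section

namespace ThreeSystem

/-- The right slope of `P` at `q` is the basis vector of index `k`. -/
def SlopeR (P : ℝ → RVec 3) (q : ℝ) (k : Fin 3) : Prop :=
  ∀ᶠ t in 𝓝[≥] q, P t = P q + (t - q) • eVec 3 k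

/-- The left slope of `P` at `q` is the basis vector of index `l`. -/
def SlopeL (P : ℝ → RVec 3) (q : ℝ) (l : Fin 3) : Prop :=
  ∀ᶠ t in 𝓝[≤] q, P t = P q + (t - q) • eVec 3 l

/-- A non-degenerate `3`-system may pass through `x` with left slope `l` and right slope `k`. -/
def Compat (x : RVec 3) (l k : Fin 3) : Prop :=
  (l < k → ∀ i, l ≤ i → i ≤ k → x i = x l) ∧ (k < l → (∀ i, 0 < x i) ∧ StrictMono x)

/-- Condition (S2), (S3) and non-degeneracy at an interior point `q`. -/
def Turn (P : ℝ → RVec 3) (q : ℝ) : Prop :=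
  ∃ k l, SlopeL P q l ∧ SlopeR P q k ∧ Compat (P q) l k

/-- Condition (S1). -/
def Admissible (x : RVec 3) (q : ℝ) : Prop :=
  (∀ i, 0 ≤ x i) ∧ Monotone x ∧ ∑ i, x i = q

lemma eVec_apply (k i : Fin 3) : eVec 3 k i = if i = k then 1 else 0 := by
  simp [eVec, Fin.ext_iff]

lemma eVec_zero : eVec 3 (0 : Fin 3) = ![1, 0, 0] := by
  ext i; fin_cases i <;> simp [eVec]

lemma eVec_one : eVec 3 (1 : Fin 3) = ![0, 1, 0] := by
  ext i; fin_cases i <;> simp [eVec]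

lemma eVec_two : eVec 3 (2 : Fin 3) = ![0, 0, 1] := by
  ext i; fin_cases i <;> simp [eVec]

lemma sum_eVec (k : Fin 3) : ∑ i, eVec 3 k i = 1 := by
  simp [eVec_apply]

lemma eventually_exists_gt {p : ℝ → Prop} {q : ℝ} (h : ∀ᶠ t in 𝓝[≥] q, p t) :
    ∃ t > q, p t := by
  have h' : ∀ᶠ t in 𝓝[>] q, p t := h.filter_mono (nhdsWithin_mono _ Ioi_subset_Ici_self)
  obtain ⟨t, ht, hq⟩ := (h'.and self_mem_nhdsWithin).exists
  exact ⟨t, hq, ht⟩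

lemma eventually_exists_lt {p : ℝ → Prop} {q : ℝ} (h : ∀ᶠ t in 𝓝[≤] q, p t) :
    ∃ t < q, p t := by
  have h' : ∀ᶠ t in 𝓝[<] q, p t := h.filter_mono (nhdsWithin_mono _ Iio_subset_Iic_self)
  obtain ⟨t, ht, hq⟩ := (h'.and self_mem_nhdsWithin).exists
  exact ⟨t, hq, ht⟩

lemma eVec_inj {c : ℝ} (hc : c ≠ 0) {k k' : Fin 3}
    (h : c • eVec 3 k = c • eVec 3 k') : k = k' := by
  have := congrFun h k
  by_contra hk
  simp [eVec_apply, hk, hc] at this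

lemma SlopeR.unique {P : ℝ → RVec 3} {q : ℝ} {k k' : Fin 3} (h : SlopeR P q k)
    (h' : SlopeR P q k') : k = k' := by
  obtain ⟨t, ht, h1, h2⟩ := eventually_exists_gt (h.and h')
  exact eVec_inj (sub_ne_zero.2 ht.ne') (add_left_cancel (h1.symm.trans h2))

lemma SlopeL.unique {P : ℝ → RVec 3} {q : ℝ} {k k' : Fin 3} (h : SlopeL P q k)
    (h' : SlopeL P q k') : k = k' := by
  obtain ⟨t, ht, h1, h2⟩ := eventually_exists_lt (h.and h')
  exact eVec_inj (sub_ne_zero.2 ht.ne) (add_left_cancel (h1.symm.trans h2))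

lemma SlopeR.congr {P Q : ℝ → RVec 3} {q : ℝ} {k : Fin 3} (h : SlopeR P q k)
    (hPQ : ∀ᶠ t in 𝓝[≥] q, Q t = P t) : SlopeR Q q k := by
  filter_upwards [h, hPQ] with t h1 h2
  rw [h2, h1, hPQ.self_of_nhdsWithin self_mem_Ici]

lemma SlopeL.congr {P Q : ℝ → RVec 3} {q : ℝ} {l : Fin 3} (h : SlopeL P q l)
    (hPQ : ∀ᶠ t in 𝓝[≤] q, Q t = P t) : SlopeL Q q l := by
  filter_upwards [h, hPQ] with t h1 h2
  rw [h2, h1, hPQ.self_of_nhdsWithin self_mem_Iic]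

lemma tendsto_div_nhdsGE {c : ℝ} (hc : 0 < c) (q : ℝ) :
    Tendsto (fun t => t / c) (𝓝[≥] q) (𝓝[≥] (q / c)) :=
  tendsto_nhdsWithin_iff.2 ⟨((continuous_id.div_const c).tendsto q).mono_left nhdsWithin_le_nhds,
    eventually_mem_nhdsWithin.mono fun _ ht => div_le_div_of_nonneg_right ht hc.le⟩

lemma tendsto_div_nhdsLE {c : ℝ} (hc : 0 < c) (q : ℝ) :
    Tendsto (fun t => t / c) (𝓝[≤] q) (𝓝[≤] (q / c)) :=
  tendsto_nhdsWithin_iff.2 ⟨((continuous_id.div_const c).tendsto q).mono_left nhdsWithin_le_nhds,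
    eventually_mem_nhdsWithin.mono fun _ ht => div_le_div_of_nonneg_right ht hc.le⟩

lemma SlopeR.scale {P : ℝ → RVec 3} {q c : ℝ} (hc : 0 < c) {k : Fin 3}
    (h : SlopeR P (q / c) k) : SlopeR (fun t => c • P (t / c)) q k := by
  filter_upwards [(tendsto_div_nhdsGE hc q).eventually h] with t ht
  rw [ht, smul_add, smul_smul, ← sub_div, mul_div_cancel₀ _ hc.ne']

lemma SlopeL.scale {P : ℝ → RVec 3} {q c : ℝ} (hc : 0 < c) {l : Fin 3}
    (h : SlopeL P (q / c) l) : SlopeL (fun t => c • P (t / c)) q l := by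
  filter_upwards [(tendsto_div_nhdsLE hc q).eventually h] with t ht
  rw [ht, smul_add, smul_smul, ← sub_div, mul_div_cancel₀ _ hc.ne']

lemma Compat.scale {x : RVec 3} {l k : Fin 3} (h : Compat x l k) {c : ℝ} (hc : 0 < c) :
    Compat (c • x) l k :=
  ⟨fun hlk i h1 h2 => by simp [h.1 hlk i h1 h2], fun hkl =>
    ⟨fun i => mul_pos hc ((h.2 hkl).1 i), fun _ _ hij =>
      mul_lt_mul_of_pos_left ((h.2 hkl).2 hij) hc⟩⟩

lemma Admissible.scale {x : RVec 3} {q : ℝ} (h : Admissible x q) {c : ℝ} (hc : 0 < c) :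
    Admissible (c • x) (c * q) :=
  ⟨fun i => mul_nonneg hc.le (h.1 i), fun _ _ hij => mul_le_mul_of_nonneg_left (h.2.1 hij) hc.le,
    by simp [← Finset.mul_sum, h.2.2]⟩

lemma Compat.refl (x : RVec 3) (k : Fin 3) : Compat x k k :=
  ⟨fun h => (lt_irrefl _ h).elim, fun h => (lt_irrefl _ h).elim⟩

lemma SlopeR.apply {P : ℝ → RVec 3} {q : ℝ} {k : Fin 3} (h : SlopeR P q k) (i : Fin 3) :
    ∀ᶠ t in 𝓝[≥] q, P t i = P q i + if i = k then t - q else 0 := by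
  filter_upwards [h] with t ht
  simp [ht, eVec_apply]

lemma SlopeL.apply {P : ℝ → RVec 3} {q : ℝ} {l : Fin 3} (h : SlopeL P q l) (i : Fin 3) :
    ∀ᶠ t in 𝓝[≤] q, P t i = P q i + if i = l then t - q else 0 := by
  filter_upwards [h] with t ht
  simp [ht, eVec_apply]

lemma SlopeR.continuousWithinAt {P : ℝ → RVec 3} {q : ℝ} {k : Fin 3} (h : SlopeR P q k) :
    ContinuousWithinAt P (Ici q) q := by
  have : ContinuousWithinAt (fun t => P q + (t - q) • eVec 3 k) (Ici q) q := by fun_prop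
  exact this.congr_of_eventuallyEq h (by simp)

lemma SlopeL.continuousWithinAt {P : ℝ → RVec 3} {q : ℝ} {l : Fin 3} (h : SlopeL P q l) :
    ContinuousWithinAt P (Iic q) q := by
  have : ContinuousWithinAt (fun t => P q + (t - q) • eVec 3 l) (Iic q) q := by fun_prop
  exact this.congr_of_eventuallyEq h (by simp)

lemma Turn.continuousAt {P : ℝ → RVec 3} {q : ℝ} (h : Turn P q) : ContinuousAt P q := by
  obtain ⟨k, l, hl, hk, -⟩ := h
  exact continuousAt_iff_continuous_left_right.2 ⟨hl.continuousWithinAt, hk.continuousWithinAt⟩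

lemma Turn.scale {P : ℝ → RVec 3} {q c : ℝ} (hc : 0 < c) (h : Turn P (q / c)) :
    Turn (fun t => c • P (t / c)) q := by
  obtain ⟨k, l, hl, hk, h⟩ := h
  exact ⟨k, l, hl.scale hc, hk.scale hc, h.scale hc⟩

lemma Turn.congr {P Q : ℝ → RVec 3} {q : ℝ} (h : Turn P q) (hPQ : ∀ᶠ t in 𝓝 q, Q t = P t) :
    Turn Q q := by
  obtain ⟨k, l, hl, hk, h⟩ := h
  refine ⟨k, l, hl.congr (hPQ.filter_mono nhdsWithin_le_nhds),
    hk.congr (hPQ.filter_mono nhdsWithin_le_nhds), ?_⟩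
  rwa [hPQ.self_of_nhds]

/-- Equality propagates to the right if it does so locally. -/
lemma eq_of_forall_eventually {f : ℝ → ℝ} {x y : ℝ} (hf : ContinuousOn f (Icc x y))
    (h : ∀ z ∈ Ico x y, (∀ w ∈ Icc x z, f w = f x) → ∀ᶠ t in 𝓝[≥] z, f t = f z) :
    ∀ t ∈ Icc x y, f t = f x := by
  rcases lt_or_ge y x with hxy | hxy
  · simp [Icc_eq_empty_of_lt hxy]
  have key : Icc x y ⊆ {z | ∀ w ∈ Icc x z, f w = f x} := by
    refine IsClosed.Icc_subset_of_forall_mem_nhdsWithin ?_ ?_ ?_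
    · rw [← closure_subset_iff_isClosed]
      intro z hz
      have hz' : z ∈ Icc x y := by
        have := closure_mono inter_subset_right hz
        rwa [closure_Icc] at this
      refine ⟨fun w hw => ?_, hz'⟩
      rcases hw.2.lt_or_eq with hwz | rfl
      · obtain ⟨v, hv, hv'⟩ := mem_closure_iff.1 hz (Ioi w) isOpen_Ioi hwz
        exact hv'.1 w ⟨hw.1, le_of_lt hv⟩
      · have hc : ContinuousWithinAt f ({z | ∀ w ∈ Icc x z, f w = f x} ∩ Icc x y) w :=
          (hf w hz').mono inter_subset_right
        have := hc.mem_closure_image hz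
        have h2 : f '' ({z | ∀ w ∈ Icc x z, f w = f x} ∩ Icc x y) ⊆ {f x} := by
          rintro _ ⟨v, ⟨hv, hv'⟩, rfl⟩
          exact hv v ⟨hv'.1, le_rfl⟩
        have h3 := closure_mono h2 this
        simpa using h3
    · intro w hw
      rw [le_antisymm hw.2 hw.1]
    · rintro z ⟨hz, hzI⟩
      have h1 := h z hzI hz
      obtain ⟨u, hu, hsub⟩ := mem_nhdsGE_iff_exists_Icc_subset.1 h1
      filter_upwards [Ioc_mem_nhdsGT hu] with t ht w hw
      rcases le_total w z with hwz | hwz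
      · exact hz w ⟨hw.1, hwz⟩
      · rw [hsub ⟨hwz, hw.2.trans ht.2⟩, hz z ⟨hzI.1, le_rfl⟩]
  exact fun t ht => key ht t ⟨ht.1, le_rfl⟩

/-- A function which is locally nondecreasing to the right is nondecreasing. -/
lemma le_of_forall_eventually {f : ℝ → ℝ} {x y : ℝ} (hxy : x ≤ y) (hf : ContinuousOn f (Icc x y))
    (h : ∀ z ∈ Ico x y, ∀ᶠ t in 𝓝[≥] z, f z ≤ f t) : f x ≤ f y := by
  have key : Icc x y ⊆ {z | f x ≤ f z} := by
    refine IsClosed.Icc_subset_of_forall_mem_nhdsWithin ?_ ?_ ?_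
    · rw [inter_comm]
      exact hf.preimage_isClosed_of_isClosed isClosed_Icc isClosed_Ici
    · exact le_rfl (a := f x)
    · rintro z ⟨hz, hzI⟩
      filter_upwards [(h z hzI).filter_mono (nhdsWithin_mono _ Ioi_subset_Ici_self)] with t ht
      exact le_trans hz ht
  exact key ⟨hxy, le_rfl⟩

/-- A non-degenerate self-similar `3`-system, seen on the open half-line `(a, ∞)`. -/
structure IsLoop (P : ℝ → RVec 3) (a ρ : ℝ) : Prop where
  pos : 0 < a
  one_lt : 1 < ρ
  adm : ∀ q > a, Admissible (P q) q
  turn : ∀ q > a, Turn P q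
  scale : ∀ q > a, P (ρ * q) = ρ • P q
  pos_zero : ∀ q > a, 0 < P q 0

namespace IsLoop

variable {P : ℝ → RVec 3} {a ρ : ℝ}

lemma lt_mul (h : IsLoop P a ρ) {q : ℝ} (hq : a < q) : q < ρ * q :=
  lt_mul_of_one_lt_left (h.pos.trans hq) h.one_lt

lemma continuousOn (h : IsLoop P a ρ) {x y : ℝ} (hx : a < x) : ContinuousOn P (Icc x y) :=
  fun _ hq => (h.turn _ (hx.trans_le hq.1)).continuousAt.continuousWithinAt

lemma exists_slopeR (h : IsLoop P a ρ) {q : ℝ} (hq : a < q) : ∃ k, SlopeR P q k := by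
  obtain ⟨k, -, -, hk, -⟩ := h.turn q hq
  exact ⟨k, hk⟩

lemma continuousOn_apply (h : IsLoop P a ρ) {x y : ℝ} (hx : a < x) (i : Fin 3) :
    ContinuousOn (fun t => P t i) (Icc x y) :=
  (continuous_apply i).comp_continuousOn (h.continuousOn hx)

lemma mono (h : IsLoop P a ρ) {x y : ℝ} (hx : a < x) (hxy : x ≤ y) (i : Fin 3) :
    P x i ≤ P y i := by
  refine le_of_forall_eventually hxy (h.continuousOn_apply hx i) fun z hz => ?_
  obtain ⟨k, hk⟩ := h.exists_slopeR (hx.trans_le hz.1)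
  filter_upwards [hk.apply i, self_mem_nhdsWithin] with t ht htz
  rw [ht]
  split_ifs
  · linarith [mem_Ici.1 htz]
  · linarith

lemma sum_eq (h : IsLoop P a ρ) {q : ℝ} (hq : a < q) : P q 0 + P q 1 + P q 2 = q := by
  rw [← Fin.sum_univ_three, (h.adm q hq).2.2]

/-- A coordinate is constant where no right slope increases it. -/
lemma apply_eq_of_slopeR_ne (h : IsLoop P a ρ) {x y : ℝ} (hx : a < x) {i : Fin 3}
    (hi : ∀ z ∈ Ico x y, ¬ SlopeR P z i) : ∀ t ∈ Icc x y, P t i = P x i := by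
  refine eq_of_forall_eventually (h.continuousOn_apply hx i) fun z hz _ => ?_
  obtain ⟨k, hk⟩ := h.exists_slopeR (hx.trans_le hz.1)
  filter_upwards [hk.apply i] with t ht
  rw [ht, if_neg, add_zero]
  rintro rfl
  exact hi z hz hk

lemma exists_slopeR_eq (h : IsLoop P a ρ) {x : ℝ} (hx : a < x) (i : Fin 3) :
    ∃ z ≥ x, SlopeR P z i := by
  by_contra! hc
  have h1 := h.apply_eq_of_slopeR_ne (y := ρ * x) hx (fun z hz => hc z hz.1) (ρ * x)
    ⟨(h.lt_mul hx).le, le_rfl⟩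
  rw [h.scale x hx, Pi.smul_apply, smul_eq_mul] at h1
  have h2 := (h.pos_zero x hx).trans_le ((h.adm x hx).2.1 (Fin.zero_le i))
  nlinarith [h.one_lt]

lemma slopeR_ne_zero (h : IsLoop P a ρ) {q : ℝ} (hq : a < q) (h01 : P q 0 = P q 1) :
    ¬ SlopeR P q 0 := by
  intro hk
  obtain ⟨t, ht, h0, h1⟩ := eventually_exists_gt ((hk.apply 0).and (hk.apply 1))
  have := (h.adm t (hq.trans ht)).2.1 (show (0 : Fin 3) ≤ 1 by decide)
  simp at h0 h1
  linarith

lemma slopeR_ne_one (h : IsLoop P a ρ) {q : ℝ} (hq : a < q) (h12 : P q 1 = P q 2) :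
    ¬ SlopeR P q 1 := by
  intro hk
  obtain ⟨t, ht, h0, h1⟩ := eventually_exists_gt ((hk.apply 1).and (hk.apply 2))
  have := (h.adm t (hq.trans ht)).2.1 (show (1 : Fin 3) ≤ 2 by decide)
  simp at h0 h1
  linarith

lemma slopeL_ne_one (h : IsLoop P a ρ) {q : ℝ} (hq : a < q) (h01 : P q 0 = P q 1) :
    ¬ SlopeL P q 1 := by
  intro hk
  obtain ⟨t, ht, ⟨h0, h1⟩, hta⟩ := eventually_exists_lt
    (((hk.apply 0).and (hk.apply 1)).and (nhdsWithin_le_nhds (Ioi_mem_nhds hq)))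
  have := (h.adm t hta).2.1 (show (0 : Fin 3) ≤ 1 by decide)
  simp at h0 h1
  linarith

/-- If a sum of coordinates is constant on `[x, z]`, the left slope at `z` is not one of them. -/
lemma notMem_of_sum_eq (h : IsLoop P a ρ) {x z : ℝ} (hx : a < x) (hxz : x < z)
    {s : Finset (Fin 3)} (hs : ∀ w ∈ Icc x z, ∑ i ∈ s, P w i = ∑ i ∈ s, P x i) {l : Fin 3}
    (hl : SlopeL P z l) : l ∉ s := by
  intro hls
  obtain ⟨t, ht, h1, h2⟩ := eventually_exists_lt
    ((hl.apply l).and (nhdsWithin_le_nhds (Ioi_mem_nhds hxz)))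
  have h3 : ∑ i ∈ s, P t i < ∑ i ∈ s, P z i := by
    refine Finset.sum_lt_sum (fun i _ => h.mono (hx.trans h2) ht.le i) ⟨l, hls, ?_⟩
    rw [h1, if_pos rfl]
    linarith
  rw [hs t ⟨le_of_lt h2, ht.le⟩, hs z ⟨hxz.le, le_rfl⟩] at h3
  exact lt_irrefl _ h3

lemma sum_eventually_eq {z : ℝ} {s : Finset (Fin 3)} {k : Fin 3} (hk : SlopeR P z k)
    (hks : k ∉ s) : ∀ᶠ t in 𝓝[≥] z, ∑ i ∈ s, P t i = ∑ i ∈ s, P z i := by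
  filter_upwards [hk] with t ht
  refine Finset.sum_congr rfl fun i hi => ?_
  have : i ≠ k := fun hik => hks (hik ▸ hi)
  simp [ht, eVec_apply, this]

/-- The right slopes stay outside `s` as long as no turn can bring them back. -/
lemma slopeR_notMem (h : IsLoop P a ρ) {x y : ℝ} (hx : a < x) (hxy : x ≤ y) {s : Finset (Fin 3)}
    {k : Fin 3} (hk : SlopeR P x k) (hks : k ∉ s)
    (hturn : ∀ z ∈ Icc x y, (∀ w ∈ Icc x z, ∑ i ∈ s, P w i = ∑ i ∈ s, P x i) →
      ∀ l ∉ s, ∀ k ∈ s, ¬ Compat (P z) l k) {j : Fin 3} (hj : SlopeR P y j) : j ∉ s := by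
  have step : ∀ z ∈ Icc x y, (∀ w ∈ Icc x z, ∑ i ∈ s, P w i = ∑ i ∈ s, P x i) →
      ∀ k', SlopeR P z k' → k' ∉ s := by
    intro z hz hw k' hk'
    rcases hz.1.eq_or_lt with rfl | hxz
    · rwa [← hk.unique hk']
    · obtain ⟨k'', l, hl, hk'', hc⟩ := h.turn z (hx.trans hxz)
      obtain rfl := hk'.unique hk''
      intro hmem
      exact hturn z hz hw l (h.notMem_of_sum_eq hx hxz hw hl) _ hmem hc
  have hcont : ContinuousOn (fun t => ∑ i ∈ s, P t i) (Icc x y) :=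
    continuousOn_finsetSum _ fun i _ => h.continuousOn_apply hx i
  refine step y ⟨hxy, le_rfl⟩ (eq_of_forall_eventually hcont fun z hz hw => ?_) j hj
  obtain ⟨k', hk'⟩ := h.exists_slopeR (hx.trans_le hz.1)
  exact sum_eventually_eq hk' (step z ⟨hz.1, hz.2.le⟩ hw k' hk')

lemma slopeR_le (h : IsLoop P a ρ) {x y : ℝ} (hx : a < x) (hxy : x ≤ y) {m k j : Fin 3}
    (hk : SlopeR P x k) (hkm : k ≤ m) (hm : ∀ z ∈ Icc x y, ∀ i, m < i → P z m < P z i)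
    (hj : SlopeR P y j) : j ≤ m := by
  have := h.slopeR_notMem (s := Finset.Ioi m) hx hxy hk (by simpa using hkm) ?_ hj
  · simpa using this
  · intro z hz _ l hl k hk hc
    rw [Finset.mem_Ioi, not_lt] at hl
    rw [Finset.mem_Ioi] at hk
    have hlk := hl.trans_lt hk
    have h1 := hc.1 hlk k hlk.le le_rfl
    have h2 := hc.1 hlk m hl hk.le
    have h3 := hm z hz k hk
    rw [h1, h2] at h3
    exact lt_irrefl _ h3

lemma lt_of_ne_zero_one (h : IsLoop P a ρ) {q : ℝ} (hq : a < q) (h01 : P q 0 ≠ P q 1) :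
    ∀ i, 0 < i → P q 0 < P q i := by
  have h1 := ((h.adm q hq).2.1 (show (0 : Fin 3) ≤ 1 by decide)).lt_of_ne h01
  intro i hi
  exact h1.trans_le ((h.adm q hq).2.1 (Fin.one_le_of_ne_zero hi.ne'))

lemma lt_of_ne_one_two (h : IsLoop P a ρ) {q : ℝ} (hq : a < q) (h12 : P q 1 ≠ P q 2) :
    ∀ i, 1 < i → P q 1 < P q i := by
  have h1 := ((h.adm q hq).2.1 (show (1 : Fin 3) ≤ 2 by decide)).lt_of_ne h12
  intro i hi
  obtain rfl : i = 2 := by lia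
  exact h1

lemma slopeR_one_of_eq (h : IsLoop P a ρ) {q : ℝ} (hq : a < q) (h01 : P q 0 = P q 1) :
    SlopeR P q 1 := by
  obtain ⟨k, hk⟩ := h.exists_slopeR hq
  have hk0 : k ≠ 0 := fun hk0 => h.slopeR_ne_zero hq h01 (hk0 ▸ hk)
  have hk2 : k ≠ 2 := by
    rintro rfl
    obtain ⟨y, hy, hy0⟩ := h.exists_slopeR_eq hq 0
    refine h.slopeR_notMem (s := {0, 1}) hq hy hk (by decide) ?_ hy0 (by decide)
    intro z hz hw l hl k hk hc
    have hlk : k < l := by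
      fin_cases k <;> fin_cases l <;> simp_all
    have h1 := hw z ⟨hz.1, le_rfl⟩
    have h2 := h.mono hq hz.1 0
    have h3 := h.mono hq hz.1 1
    have h4 := (hc.2 hlk).2 (show (0 : Fin 3) < 1 by decide)
    simp at h1
    linarith
  obtain rfl : k = 1 := by lia
  exact hk

lemma slopeL_zero_of_eq (h : IsLoop P a ρ) {q : ℝ} (hq : a < q) (h01 : P q 0 = P q 1) :
    SlopeL P q 0 := by
  obtain ⟨k, l, hl, hk, hc⟩ := h.turn q hq
  obtain rfl := hk.unique (h.slopeR_one_of_eq hq h01)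
  have hl1 : l ≠ 1 := fun hl1 => h.slopeL_ne_one hq h01 (hl1 ▸ hl)
  have hl2 : l ≠ 2 := by
    rintro rfl
    have := (hc.2 (by decide)).2 (show (0 : Fin 3) < 1 by decide)
    exact this.ne h01
  obtain rfl : l = 0 := by lia
  exact hl

lemma exists_eq_zero_one (h : IsLoop P a ρ) {x : ℝ} (hx : a < x) :
    ∃ z ≥ x, P z 0 = P z 1 := by
  by_contra! hc
  obtain ⟨w, hw, hw0⟩ := h.exists_slopeR_eq hx 0
  obtain ⟨y, hy, hy2⟩ := h.exists_slopeR_eq (hx.trans_le hw) 2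
  have := h.slopeR_le (hx.trans_le hw) hy hw0 le_rfl (fun z hz =>
    h.lt_of_ne_zero_one (hx.trans_le (hw.trans hz.1)) (hc z (hw.trans hz.1))) hy2
  exact absurd this (by decide)

/-- A self-similar system contains a rise of its middle coordinate from the lowest level to the
highest one. -/
lemma exists_rise (h : IsLoop P a ρ) : ∃ q₁ q₂ u v : ℝ, a < q₁ ∧ q₁ < q₂ ∧ 0 < u ∧ u < v ∧
    P q₁ = ![u, u, v] ∧ P q₂ = ![u, v, v] ∧ (∀ t ∈ Icc q₁ q₂, P t = ![u, t - u - v, v]) ∧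
    SlopeL P q₁ 0 ∧ SlopeR P q₁ 1 ∧ SlopeL P q₂ 1 ∧ SlopeR P q₂ 2 := by
  obtain ⟨z₀, hz₀, hz01⟩ := h.exists_eq_zero_one (lt_add_one a)
  replace hz₀ : a < z₀ := (lt_add_one a).trans_le hz₀
  obtain ⟨x, hx, hx2⟩ := h.exists_slopeR_eq hz₀ 2
  have hcompact : IsCompact {z ∈ Icc z₀ x | P z 0 = P z 1} :=
    isCompact_Icc.of_isClosed_subset
      (isClosed_Icc.isClosed_eq (h.continuousOn_apply hz₀ 0) (h.continuousOn_apply hz₀ 1))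
      (sep_subset _ _)
  obtain ⟨q₁, ⟨⟨h01, h1x⟩, h1⟩, hmax⟩ := hcompact.exists_isGreatest ⟨z₀, ⟨le_rfl, hx⟩, hz01⟩
  have ha1 : a < q₁ := hz₀.trans_le h01
  have hR1 := h.slopeR_one_of_eq ha1 h1
  have hlt : ∀ z ∈ Ioc q₁ x, P z 0 ≠ P z 1 := fun z hz heq =>
    hz.1.not_ge (hmax ⟨⟨h01.trans hz.1.le, hz.2⟩, heq⟩)
  have hne0 : ∀ z ∈ Icc q₁ x, ¬ SlopeR P z 0 := by
    intro z hz hz0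
    rcases hz.1.eq_or_lt with rfl | hz1
    · exact absurd (hR1.unique hz0) (by decide)
    · have := h.slopeR_le (ha1.trans hz1) hz.2 hz0 le_rfl (fun w hw =>
        h.lt_of_ne_zero_one (ha1.trans (hz1.trans_le hw.1))
          (hlt w ⟨hz1.trans_le hw.1, hw.2⟩)) hx2
      exact absurd this (by decide)
  have hcompact' : IsCompact {z ∈ Icc q₁ x | P z 1 = P z 2} :=
    isCompact_Icc.of_isClosed_subset
      (isClosed_Icc.isClosed_eq (h.continuousOn_apply ha1 1) (h.continuousOn_apply ha1 2))
      (sep_subset _ _)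
  have hne : {z ∈ Icc q₁ x | P z 1 = P z 2}.Nonempty := by
    by_contra hempty
    have := h.slopeR_le (m := 1) ha1 h1x hR1 le_rfl (fun w hw =>
      h.lt_of_ne_one_two (ha1.trans_le hw.1) fun heq => hempty ⟨w, hw, heq⟩) hx2
    exact absurd this (by decide)
  obtain ⟨q₂, ⟨⟨h12, h2x⟩, h2⟩, hmin⟩ := hcompact'.exists_isLeast hne
  have h12' : q₁ < q₂ := by
    refine h12.lt_of_ne ?_
    rintro rfl
    exact h.slopeR_ne_one ha1 h2 hR1
  have ha2 := ha1.trans h12'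
  have hne2 : ∀ z ∈ Ico q₁ q₂, ¬ SlopeR P z 2 := by
    intro z hz hz2
    have := h.slopeR_le (m := 1) ha1 hz.1 hR1 le_rfl (fun w hw =>
      h.lt_of_ne_one_two (ha1.trans_le hw.1) fun heq =>
        (hw.2.trans_lt hz.2).not_ge (hmin ⟨⟨hw.1, hw.2.trans (hz.2.le.trans h2x)⟩, heq⟩)) hz2
    exact absurd this (by decide)
  have hP0 := h.apply_eq_of_slopeR_ne ha1 fun z (hz : z ∈ Ico q₁ q₂) =>
    hne0 z ⟨hz.1, hz.2.le.trans h2x⟩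
  have hP2 := h.apply_eq_of_slopeR_ne ha1 hne2
  have hP : ∀ t ∈ Icc q₁ q₂, P t = ![P q₁ 0, t - P q₁ 0 - P q₁ 2, P q₁ 2] := by
    intro t ht
    have hs := h.sum_eq (ha1.trans_le ht.1)
    ext i
    fin_cases i
    · exact hP0 t ht
    · simp only [← hP0 t ht, ← hP2 t ht]
      simp
      linarith
    · exact hP2 t ht
  have h12v : P q₂ 1 = P q₁ 2 := h2.trans (hP2 q₂ ⟨h12, le_rfl⟩)
  have hm12 : P q₁ 1 < P q₁ 2 := by
    have := h.sum_eq ha1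
    have h3 := h.sum_eq ha2
    have h4 := hP0 q₂ ⟨h12, le_rfl⟩
    linarith
  refine ⟨q₁, q₂, P q₁ 0, P q₁ 2, ha1, h12', h.pos_zero q₁ ha1, h1.trans_lt hm12, ?_, ?_, hP,
    h.slopeL_zero_of_eq ha1 h1, hR1, ?_, ?_⟩
  · ext i
    fin_cases i
    · rfl
    · exact h1.symm
    · rfl
  · ext i
    fin_cases i
    · exact hP0 q₂ ⟨h12, le_rfl⟩
    · exact h12v
    · exact hP2 q₂ ⟨h12, le_rfl⟩
  · filter_upwards [Icc_mem_nhdsLE h12'] with t ht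
    rw [hP t ht, hP q₂ ⟨h12, le_rfl⟩]
    ext i
    fin_cases i <;> simp [eVec]
    ring
  · obtain ⟨k, hk⟩ := h.exists_slopeR ha2
    have hk0 : k ≠ 0 := fun hk0 => hne0 q₂ ⟨h12, h2x⟩ (hk0 ▸ hk)
    have hk1 : k ≠ 1 := fun hk1 => h.slopeR_ne_one ha2 h2 (hk1 ▸ hk)
    obtain rfl : k = 2 := by lia
    exact hk

end IsLoop

namespace IsLoop

variable {P : ℝ → RVec 3} {a ρ : ℝ}

lemma scale_pow (h : IsLoop P a ρ) {q : ℝ} (hq : a < q) (n : ℕ) :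
    a < ρ ^ n * q ∧ P (ρ ^ n * q) = ρ ^ n • P q := by
  induction n with
  | zero => simpa using hq
  | succ n ih =>
    have h1 : ρ ^ (n + 1) * q = ρ * (ρ ^ n * q) := by ring
    rw [h1, h.scale _ ih.1, ih.2, smul_smul, pow_succ']
    exact ⟨ih.1.trans (h.lt_mul ih.1), rfl⟩

/-- Every point of the system is proportional to a point in a given period. -/
lemma exists_scale_mem (h : IsLoop P a ρ) {x q : ℝ} (hx : a < x) (hq : a < q) :
    ∃ c > 0, c * q ∈ Icc x (ρ * x) ∧ P (c * q) = c • P q := by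
  have hx0 := h.pos.trans hx
  have hq0 := h.pos.trans hq
  have hρ : 0 < ρ := one_pos.trans h.one_lt
  obtain ⟨n, hn1, hn2⟩ := exists_mem_Ico_zpow (div_pos hq0 hx0) h.one_lt
  rw [le_div_iff₀ hx0] at hn1
  rw [div_lt_iff₀ hx0, zpow_add_one₀ hρ.ne'] at hn2
  have hpos : 0 < ρ ^ n := zpow_pos hρ n
  have hmem : (ρ ^ n)⁻¹ * q ∈ Icc x (ρ * x) := by
    rw [inv_mul_eq_div, mem_Icc, le_div_iff₀ hpos, div_le_iff₀ hpos]
    constructor <;> nlinarith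
  refine ⟨(ρ ^ n)⁻¹, inv_pos.2 hpos, hmem, ?_⟩
  obtain ⟨m, rfl | rfl⟩ := n.eq_nat_or_neg
  · have := (h.scale_pow (hx.trans_le hmem.1) m).2
    rw [zpow_natCast] at this ⊢
    rw [mul_inv_cancel_left₀ (pow_pos hρ m).ne'] at this
    rw [this, inv_smul_smul₀ (pow_pos hρ m).ne']
  · have := (h.scale_pow hq m).2
    rwa [zpow_neg, zpow_natCast, inv_inv]

lemma fSet_eq (h : IsLoop P a ρ) (b : ℝ) :
    FSet 3 (Ici b) P = (fun q => q⁻¹ • P q) '' Ioi a := by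
  have hρ : 0 < ρ := one_pos.trans h.one_lt
  apply Subset.antisymm
  · rintro x ⟨q, -, -, hq, hx⟩
    have hc : IsCompact ((fun q => q⁻¹ • P q) '' Icc (a + 1) (ρ * (a + 1))) := by
      refine isCompact_Icc.image_of_continuousOn (ContinuousOn.fun_smul ?_ ?_)
      · exact continuousOn_id.inv₀ fun t ht => (h.pos.trans ((lt_add_one a).trans_le ht.1)).ne'
      · exact h.continuousOn (lt_add_one a)
    have hmem : x ∈ (fun q => q⁻¹ • P q) '' Icc (a + 1) (ρ * (a + 1)) := by
      refine hc.isClosed.mem_of_tendsto hx ?_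
      filter_upwards [hq.eventually_gt_atTop a] with i hi
      obtain ⟨c, hc0, hcm, hcP⟩ := h.exists_scale_mem (lt_add_one a) hi
      refine ⟨_, hcm, ?_⟩
      simp only [hcP, smul_smul, mul_inv]
      rw [mul_right_comm, inv_mul_cancel₀ hc0.ne', one_mul]
    obtain ⟨q, hq, rfl⟩ := hmem
    exact ⟨q, (lt_add_one a).trans_le hq.1, rfl⟩
  · rintro _ ⟨q, hq, rfl⟩
    have hq0 : 0 < q := h.pos.trans hq
    obtain ⟨m, hm⟩ := pow_unbounded_of_one_lt (b / q) h.one_lt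
    rw [div_lt_iff₀ hq0] at hm
    have htend : Tendsto (fun i : ℕ => ρ ^ (i + m) * q) atTop atTop :=
      ((tendsto_pow_atTop_atTop_of_one_lt h.one_lt).comp
        (tendsto_add_atTop_nat m)).atTop_mul_const hq0
    have hmono : StrictMono fun i : ℕ => ρ ^ (i + m) * q := fun i j hij =>
      mul_lt_mul_of_pos_right (pow_lt_pow_right₀ h.one_lt (by lia)) hq0
    refine ⟨fun i => ρ ^ (i + m) * q, fun i => ?_, hmono, htend, ?_⟩
    · refine hm.le.trans ?_
      have := hmono.monotone (Nat.zero_le i)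
      simpa using this
    · refine tendsto_const_nhds.congr fun i => ?_
      rw [(h.scale_pow hq _).2, smul_smul, mul_inv, mul_right_comm,
        inv_mul_cancel₀ (pow_pos hρ _).ne', one_mul]

end IsLoop

/-- The local form of a slope of a system at an interior point of its domain. -/
lemma slopeR_of_forall {I : Set ℝ} {P : ℝ → RVec 3} {q ε : ℝ} (hI : q ∈ interior I) (hε : 0 < ε)
    {k : Fin 3} (hk : ∀ t ∈ I ∩ Icc q (q + ε), P t = P q + (t - q) • eVec 3 k) :
    SlopeR P q k := by
  filter_upwards [nhdsWithin_le_nhds (mem_interior_iff_mem_nhds.1 hI),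
    Icc_mem_nhdsGE (show q < q + ε by linarith)] with t h1 h2
  exact hk t ⟨h1, h2⟩

lemma slopeL_of_forall {I : Set ℝ} {P : ℝ → RVec 3} {q ε : ℝ} (hI : q ∈ interior I) (hε : 0 < ε)
    {l : Fin 3} (hl : ∀ t ∈ I ∩ Icc (q - ε) q, P t = P q + (t - q) • eVec 3 l) :
    SlopeL P q l := by
  filter_upwards [nhdsWithin_le_nhds (mem_interior_iff_mem_nhds.1 hI),
    Icc_mem_nhdsLE (show q - ε < q by linarith)] with t h1 h2
  exact hl t ⟨h1, h2⟩

lemma exists_isLoop {I : Set ℝ} {P : ℝ → RVec 3} (h : IsNonDegenerate 3 I P)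
    (hs : IsSelfSimilar 3 I P) : ∃ a ρ, I = Ici a ∧ IsLoop P a ρ := by
  obtain ⟨⟨-, hord, hne, hsys⟩, hclosed, hpos, hswitch⟩ := h
  obtain ⟨hunb, ρ, hρ, hscale⟩ := hs
  have hne' : I.Nonempty := hne.mono interior_subset
  have hbdd : BddBelow I := ⟨0, fun x hx => le_of_lt (hpos hx)⟩
  obtain ⟨a, haI, hlow⟩ : ∃ a ∈ I, ∀ x ∈ I, a ≤ x :=
    ⟨sInf I, hclosed.csInf_mem hne' hbdd, fun x hx => csInf_le hbdd hx⟩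
  obtain rfl : I = Ici a := by
    refine Subset.antisymm hlow fun x hx => ?_
    obtain ⟨y, hy, hxy⟩ := not_bddAbove_iff.1 hunb x
    exact hord.out haI hy ⟨hx, hxy.le⟩
  have ha0 : 0 < a := hpos haI
  have hturn : ∀ q > a, Turn P q := by
    intro q hq
    have hqI : q ∈ interior (Ici a) := by rwa [interior_Ici]
    obtain ⟨-, ε, hε, k, l, hl, hk, hkl⟩ := hsys q (le_of_lt hq)
    refine ⟨k, l, slopeL_of_forall hqI hε hl, slopeR_of_forall hqI hε hk, hkl hqI, fun h => ?_⟩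
    exact hswitch q ⟨le_of_lt hq, Or.inr ⟨hqI, ε, hε, k, l, h, hl, hk⟩⟩
  refine ⟨a, ρ, rfl, ha0, hρ, fun q hq => (hsys q (le_of_lt hq)).1, hturn,
    fun q hq => (hscale q (le_of_lt hq)).2, fun q hq => ?_⟩
  have hPa : 0 < P a 0 := (hswitch a ⟨haI, Or.inl (by rw [frontier_Ici]; rfl)⟩).1 0
  obtain ⟨-, ε, hε, k, l, -, hk, -⟩ := hsys a haI
  set x := min q (a + ε)
  have hax : a < x := lt_min hq (by linarith)
  have h1 : P x 0 = P a 0 + (x - a) * eVec 3 k 0 := by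
    rw [hk x ⟨hax.le, hax.le, min_le_right _ _⟩]
    simp
  have h2 : P x 0 ≤ P q 0 := by
    refine le_of_forall_eventually (f := fun t => P t 0) (min_le_left _ _) ?_ fun z hz => ?_
    · exact fun z hz => ((continuous_apply (0 : Fin 3)).continuousAt.comp
        (hturn z (hax.trans_le hz.1)).continuousAt).continuousWithinAt
    · obtain ⟨j, -, -, hj, -⟩ := hturn z (hax.trans_le hz.1)
      filter_upwards [hj.apply 0, self_mem_nhdsWithin] with t ht htz
      rw [ht]
      split_ifs
      · linarith [mem_Ici.1 htz]
      · linarith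
  have h3 : 0 ≤ (x - a) * eVec 3 k 0 := by
    rw [eVec_apply]
    split_ifs <;> linarith
  linarith

/-- A non-degenerate path in the cone `C` which goes from `x` to `y`, starts with slope `k`, ends
with slope `l` and passes through a positive multiple of each point of `D`. -/
def Reach (C : ConvexCone ℝ (RVec 3)) (D : Set (RVec 3)) (k : Fin 3) (x : RVec 3) (l : Fin 3)
    (y : RVec 3) : Prop :=
  ∃ (P : ℝ → RVec 3) (a b : ℝ), a < b ∧ P a = x ∧ P b = y ∧ SlopeR P a k ∧ SlopeL P b l ∧
    (∀ q ∈ Ioo a b, Turn P q) ∧ (∀ q ∈ Icc a b, P q ∈ C ∧ ∑ i, P q i = q) ∧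
    ∀ d ∈ D, ∃ t ∈ Icc a b, ∃ c > (0 : ℝ), P t = c • d

section Reach

variable {C : ConvexCone ℝ (RVec 3)} {D D' : Set (RVec 3)} {k k' l l' : Fin 3} {x y z : RVec 3}

lemma Reach.trans (h : Reach C D k x l y) (h' : Reach C D' k' y l' z) (hc : Compat y l k') :
    Reach C (D ∪ D') k x l' z := by
  obtain ⟨P, a, b, hab, rfl, hPb, hR, hL, hT, hC, hD⟩ := h
  obtain ⟨Q, b', c, hbc, hQb, rfl, hR', hL', hT', hC', hD'⟩ := h'
  obtain rfl : b = b' := by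
    rw [← (hC b ⟨hab.le, le_rfl⟩).2, ← (hC' b' ⟨le_rfl, hbc.le⟩).2, hPb, hQb]
  set S : ℝ → RVec 3 := fun t => if t ≤ b then P t else Q t
  have hSP : ∀ t ≤ b, S t = P t := fun t ht => if_pos ht
  have hSQ : ∀ t ≥ b, S t = Q t := by
    intro t ht
    rcases (ge_iff_le.1 ht).eq_or_lt with rfl | ht
    · rw [hSP _ le_rfl, hPb, hQb]
    · exact if_neg ht.not_ge
  refine ⟨S, a, c, hab.trans hbc, hSP a hab.le, hSQ c hbc.le, hR.congr ?_, hL'.congr ?_,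
    ?_, ?_, ?_⟩
  · filter_upwards [Icc_mem_nhdsGE hab] with t ht using hSP t ht.2
  · filter_upwards [Icc_mem_nhdsLE hbc] with t ht using hSQ t ht.1
  · intro q hq
    rcases lt_trichotomy q b with hqb | rfl | hqb
    · exact (hT q ⟨hq.1, hqb⟩).congr
        (mem_of_superset (Iio_mem_nhds hqb) fun t ht => hSP t (le_of_lt ht))
    · refine ⟨k', l, hL.congr ?_, hR'.congr ?_, by rwa [hSP _ le_rfl, hPb]⟩
      · exact eventually_mem_nhdsWithin.mono hSP
      · exact eventually_mem_nhdsWithin.mono hSQ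
    · exact (hT' q ⟨hqb, hq.2⟩).congr
        (mem_of_superset (Ioi_mem_nhds hqb) fun t ht => hSQ t (le_of_lt ht))
  · intro q hq
    rcases le_total q b with hqb | hqb
    · rw [hSP q hqb]
      exact hC q ⟨hq.1, hqb⟩
    · rw [hSQ q hqb]
      exact hC' q ⟨hqb, hq.2⟩
  · rintro d (hd | hd)
    · obtain ⟨t, ht, e, he, hP⟩ := hD d hd
      exact ⟨t, ⟨ht.1, ht.2.trans hbc.le⟩, e, he, (hSP t ht.2).trans hP⟩
    · obtain ⟨t, ht, e, he, hP⟩ := hD' d hd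
      exact ⟨t, ⟨hab.le.trans ht.1, ht.2⟩, e, he, (hSQ t ht.1).trans hP⟩

lemma Reach.smul (h : Reach C D k x l y) {c : ℝ} (hc : 0 < c) :
    Reach C D k (c • x) l (c • y) := by
  obtain ⟨P, a, b, hab, rfl, rfl, hR, hL, hT, hC, hD⟩ := h
  have hdiv : ∀ t, c * t / c = t := fun t => mul_div_cancel_left₀ t hc.ne'
  refine ⟨fun t => c • P (t / c), c * a, c * b, mul_lt_mul_of_pos_left hab hc, by simp [hdiv],
    by simp [hdiv], SlopeR.scale hc (by rwa [hdiv]), SlopeL.scale hc (by rwa [hdiv]),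
    fun q hq => Turn.scale hc (hT _ ?_), fun q hq => ?_, fun d hd => ?_⟩
  · rwa [mem_Ioo, lt_div_iff₀' hc, div_lt_iff₀' hc]
  · have h1 : q / c ∈ Icc a b := by rwa [mem_Icc, le_div_iff₀' hc, div_le_iff₀' hc]
    refine ⟨C.smul_mem hc (hC _ h1).1, ?_⟩
    simp only [Pi.smul_apply, smul_eq_mul]
    rw [← Finset.mul_sum, (hC _ h1).2, mul_div_cancel₀ _ hc.ne']
  · obtain ⟨t, ht, e, he, hP⟩ := hD d hd
    refine ⟨c * t, ⟨mul_le_mul_of_nonneg_left ht.1 hc.le, mul_le_mul_of_nonneg_left ht.2 hc.le⟩,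
      c * e, mul_pos hc he, ?_⟩
    simp only [hdiv, hP, smul_smul]

lemma Reach.mono (h : Reach C D k x l y) (hD : D' ⊆ D) : Reach C D' k x l y := by
  obtain ⟨P, a, b, hab, h1, h2, hR, hL, hT, hC, hD'⟩ := h
  exact ⟨P, a, b, hab, h1, h2, hR, hL, hT, hC, fun d hd => hD' d (hD hd)⟩

lemma Reach.sum_lt (h : Reach C D k x l y) : ∑ i, x i < ∑ i, y i := by
  obtain ⟨P, a, b, hab, rfl, rfl, -, -, -, hC, -⟩ := h
  rwa [(hC a ⟨le_rfl, hab.le⟩).2, (hC b ⟨hab.le, le_rfl⟩).2]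

/-- A path along a line segment. -/
lemma reach_segment (hx : x ∈ C) {d : ℝ} (hd : 0 < d) (hy : x + d • eVec 3 k ∈ C) :
    Reach C ∅ k x k (x + d • eVec 3 k) := by
  set s := ∑ i, x i with hs
  set P : ℝ → RVec 3 := fun t => x + (t - s) • eVec 3 k with hP
  have hPP : ∀ q t, P t = P q + (t - q) • eVec 3 k := by
    intro q t
    simp only [hP]
    module
  refine ⟨P, s, s + d, by linarith, by simp [hP], by simp [hP], .of_forall (hPP _),
    .of_forall (hPP _), fun q hq => ⟨k, k, .of_forall (hPP _), .of_forall (hPP _), .refl _ _⟩,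
    fun q hq => ⟨?_, ?_⟩, by simp⟩
  · obtain ⟨r, hr⟩ : ∃ r, q - s = r * d := ⟨(q - s) / d, (div_mul_cancel₀ _ hd.ne').symm⟩
    have hr0 : 0 ≤ r := nonneg_of_mul_nonneg_left (by linarith [hq.1]) hd
    have hr1 : r ≤ 1 := le_of_mul_le_mul_right (by linarith [hq.2]) hd
    have hmem := C.convex hx hy (sub_nonneg.2 hr1) hr0 (by ring)
    have hPq : P q = (1 - r) • x + r • (x + d • eVec 3 k) := by
      simp only [hP, hr]
      module
    rwa [hPq]
  · simp only [hP, Pi.add_apply, Pi.smul_apply, smul_eq_mul]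
    rw [Finset.sum_add_distrib, ← Finset.mul_sum, sum_eVec, ← hs]
    ring

end Reach

/-- The self-similar extension, with ratio `ρ`, of a path defined on `[a, ρ * a]`. -/
def selfSimilarExt (P : ℝ → RVec 3) (a ρ : ℝ) (q : ℝ) : RVec 3 :=
  ρ ^ ⌊Real.logb ρ (q / a)⌋ • P (q / ρ ^ ⌊Real.logb ρ (q / a)⌋)

section selfSimilarExt

variable {P : ℝ → RVec 3} {a ρ : ℝ}

lemma selfSimilarExt_mul (ha : 0 < a) (hρ : 1 < ρ) {q : ℝ} (hq : 0 < q) :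
    selfSimilarExt P a ρ (ρ * q) = ρ • selfSimilarExt P a ρ q := by
  have hρ0 : 0 < ρ := one_pos.trans hρ
  have h1 : Real.logb ρ (ρ * q / a) = Real.logb ρ (q / a) + 1 := by
    rw [mul_div_assoc, Real.logb_mul hρ0.ne' (div_pos hq ha).ne', Real.logb_self_eq_one hρ,
      add_comm]
  unfold selfSimilarExt
  rw [h1, Int.floor_add_one, zpow_add_one₀ hρ0.ne', mul_comm _ ρ, mul_smul,
    mul_div_mul_left _ _ hρ0.ne']

lemma selfSimilarExt_eq (ha : 0 < a) (hρ : 1 < ρ) (hP : P (ρ * a) = ρ • P a) {q : ℝ}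
    (hq : q ∈ Icc a (ρ * a)) : selfSimilarExt P a ρ q = P q := by
  have hlt : ∀ q ∈ Ico a (ρ * a), selfSimilarExt P a ρ q = P q := by
    intro q hq
    have h1 : ⌊Real.logb ρ (q / a)⌋ = 0 := by
      rw [Int.floor_eq_zero_iff]
      refine ⟨Real.logb_nonneg hρ ((one_le_div ha).2 hq.1), ?_⟩
      rw [← Real.logb_self_eq_one hρ]
      exact Real.logb_lt_logb hρ (div_pos (ha.trans_le hq.1) ha) ((div_lt_iff₀ ha).2 hq.2)
    simp [selfSimilarExt, h1]
  rcases hq.2.lt_or_eq with h | rfl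
  · exact hlt q ⟨hq.1, h⟩
  · rw [selfSimilarExt_mul ha hρ ha, hP, hlt a ⟨le_rfl, lt_mul_of_one_lt_left ha hρ⟩]

end selfSimilarExt

/-- A closed path, up to a dilation, extends to a self-similar system. -/
lemma Reach.exists_isLoop {C : ConvexCone ℝ (RVec 3)} {D : Set (RVec 3)} {k l : Fin 3}
    {x : RVec 3} {ρ : ℝ} (hC : ∀ x ∈ C, 0 < x 0 ∧ Monotone x) (h : Reach C D k x l (ρ • x))
    (hc : Compat x l k) : ∃ S a, IsLoop S a ρ ∧ (∀ q > a, S q ∈ C) ∧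
      (∀ d ∈ D, ∃ q > a, ∃ c > (0 : ℝ), S q = c • d) ∧ SlopeR S a k ∧ S a = x := by
  have hsum := h.sum_lt
  obtain ⟨P, a, b, hab, rfl, hPb, hR, hL, hT, hPC, hD⟩ := h
  have ha0 : 0 < a := by
    have h1 := hPC a ⟨le_rfl, hab.le⟩
    have h2 := hC _ h1.1
    rw [← h1.2]
    exact Finset.sum_pos (fun i _ => h2.1.trans_le (h2.2 (Fin.zero_le i))) Finset.univ_nonempty
  obtain rfl : b = ρ * a := by
    have h1 := (hPC b ⟨hab.le, le_rfl⟩).2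
    have h2 := (hPC a ⟨le_rfl, hab.le⟩).2
    simp only [hPb, Pi.smul_apply, smul_eq_mul, ← Finset.mul_sum, h2] at h1
    exact h1.symm
  have hρ : 1 < ρ := by
    by_contra! hle
    nlinarith
  have hρ0 : 0 < ρ := one_pos.trans hρ
  set S := selfSimilarExt P a ρ
  have hSP : ∀ q ∈ Icc a (ρ * a), S q = P q := fun q => selfSimilarExt_eq ha0 hρ hPb
  have hSmul : ∀ q > 0, S (ρ * q) = ρ • S q := fun q => selfSimilarExt_mul ha0 hρ
  have hSdiv : ∀ q > 0, ρ • S (q / ρ) = S q := fun q hq => by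
    rw [← hSmul _ (div_pos hq hρ0), mul_div_cancel₀ _ hρ0.ne']
  have hSR : SlopeR S a k := hR.congr (mem_of_superset (Icc_mem_nhdsGE hab) hSP)
  have hSR' : SlopeR S (ρ * a) k := by
    refine SlopeR.congr (SlopeR.scale hρ0 (by rwa [mul_div_cancel_left₀ _ hρ0.ne'])) ?_
    filter_upwards [self_mem_nhdsWithin] with t ht
    exact (hSdiv t ((mul_pos hρ0 ha0).trans_le ht)).symm
  have hSL : SlopeL S (ρ * a) l := hL.congr (mem_of_superset (Icc_mem_nhdsLE hab) hSP)
  have hbase : ∀ q ∈ Ioc a (ρ * a), Turn S q ∧ S q ∈ C ∧ ∑ i, S q i = q := by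
    intro q hq
    refine ⟨?_, ?_⟩
    · rcases hq.2.lt_or_eq with hqb | rfl
      · exact (hT q ⟨hq.1, hqb⟩).congr
          (mem_of_superset (Icc_mem_nhds hq.1 hqb) hSP)
      · refine ⟨k, l, hSL, hSR', ?_⟩
        rw [hSP _ ⟨hab.le, le_rfl⟩, hPb]
        exact hc.scale hρ0
    · rw [hSP q ⟨hq.1.le, hq.2⟩]
      exact hPC q ⟨hq.1.le, hq.2⟩
  have hind : ∀ n : ℕ, ∀ q, a < q → q ≤ ρ ^ n * a → Turn S q ∧ S q ∈ C ∧ ∑ i, S q i = q := by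
    intro n
    induction n with
    | zero =>
      intro q hq hq'
      rw [pow_zero, one_mul] at hq'
      exact absurd hq hq'.not_gt
    | succ n ih =>
      intro q hq hq'
      rcases le_or_gt q (ρ * a) with hqb | hqb
      · exact hbase q ⟨hq, hqb⟩
      · have hq0 := ha0.trans hq
        obtain ⟨h1, h2, h3⟩ := ih (q / ρ) (by rwa [lt_div_iff₀' hρ0])
          ((div_le_iff₀ hρ0).2 (hq'.trans_eq (by ring)))
        refine ⟨(h1.scale hρ0).congr ?_, ?_, ?_⟩
        · filter_upwards [Ioi_mem_nhds hq0] with t ht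
          exact (hSdiv t ht).symm
        · rw [← hSdiv q hq0]
          exact C.smul_mem hρ0 h2
        · rw [← hSdiv q hq0]
          simp only [Pi.smul_apply, smul_eq_mul]
          rw [← Finset.mul_sum, h3, mul_div_cancel₀ _ hρ0.ne']
  have hall : ∀ q > a, Turn S q ∧ S q ∈ C ∧ ∑ i, S q i = q := by
    intro q hq
    obtain ⟨n, hn⟩ := pow_unbounded_of_one_lt (q / a) hρ
    exact hind n q hq ((div_lt_iff₀ ha0).1 hn).le
  refine ⟨S, a, ⟨ha0, hρ, fun q hq => ?_, fun q hq => (hall q hq).1,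
    fun q hq => hSmul q (ha0.trans hq), fun q hq => (hC _ (hall q hq).2.1).1⟩,
    fun q hq => (hall q hq).2.1, fun d hd => ?_, hSR, hSP a ⟨le_rfl, hab.le⟩⟩
  · have h1 := hC _ (hall q hq).2.1
    exact ⟨fun i => h1.1.le.trans (h1.2 (Fin.zero_le i)), h1.2, (hall q hq).2.2⟩
  · obtain ⟨t, ht, c, hc0, hPt⟩ := hD d hd
    rcases ht.1.eq_or_lt with rfl | hat
    · refine ⟨ρ * a, hab, ρ * c, mul_pos hρ0 hc0, ?_⟩
      rw [hSP _ ⟨hab.le, le_rfl⟩, hPb, hPt, smul_smul]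
    · exact ⟨t, hat, c, hc0, (hSP t ht).trans hPt⟩

/-- A self-similar system starting at a point with distinct positive coordinates is
non-degenerate. -/
lemma IsLoop.isNonDegenerate {P : ℝ → RVec 3} {a ρ b : ℝ} (h : IsLoop P a ρ) (hab : a < b)
    (hb : StrictMono (P b)) : IsNonDegenerate 3 (Ici b) P ∧ IsSelfSimilar 3 (Ici b) P := by
  have hb0 : 0 < b := h.pos.trans hab
  refine ⟨⟨⟨Ici_subset_Ici.2 hb0.le, ordConnected_Ici, by simp, fun q hq => ?_⟩, isClosed_Ici,
    fun q hq => hb0.trans_le hq, ?_⟩, not_bddAbove_Ici b, ρ, h.one_lt, fun q hq => ?_⟩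
  · have hq' : a < q := hab.trans_le hq
    refine ⟨h.adm q hq', ?_⟩
    obtain ⟨k, l, hl, hk, hc⟩ := h.turn q hq'
    obtain ⟨u, hu, hsub⟩ := mem_nhdsGE_iff_exists_Icc_subset.1 hk
    obtain ⟨v, hv, hsub'⟩ := mem_nhdsLE_iff_exists_Icc_subset.1 hl
    refine ⟨min (u - q) (q - v), lt_min (sub_pos.2 hu) (sub_pos.2 hv), k, l,
      fun t ht => hsub' ⟨?_, ht.2.2⟩, fun t ht => hsub ⟨ht.2.1, ?_⟩, fun _ hlk => hc.1 hlk⟩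
    · linarith [ht.2.1, min_le_right (u - q) (q - v)]
    · linarith [ht.2.2, min_le_left (u - q) (q - v)]
  · rintro q ⟨hq, hq' | ⟨hqi, ε, hε, k, l, hkl, hl, hk⟩⟩
    · rw [frontier_Ici, mem_singleton_iff] at hq'
      subst hq'
      exact ⟨fun i => (h.pos_zero q hab).trans_le (hb.monotone (Fin.zero_le i)), hb⟩
    · obtain ⟨k', l', hl', hk', hc⟩ := h.turn q (hab.trans_le hq)
      obtain rfl := hk'.unique (slopeR_of_forall hqi hε hk)
      obtain rfl := hl'.unique (slopeL_of_forall hqi hε hl)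
      exact hc.2 hkl
  · have hq' : a < q := hab.trans_le hq
    exact ⟨le_trans hq (h.lt_mul hq').le, h.scale q hq'⟩

section Zigzag

variable {C : ConvexCone ℝ (RVec 3)} {D D' : Set (RVec 3)} {k : Fin 3} {x : RVec 3}
  {α β θ c : ℝ}

lemma strictMono_vec {a b c : ℝ} (hab : a < b) (hbc : b < c) : StrictMono ![a, b, c] := by
  rw [Fin.strictMono_iff_lt_succ]
  intro i
  fin_cases i
  · exact hab
  · exact hbc

lemma compat_of_lt {a b c : ℝ} (ha : 0 < a) (hab : a < b) (hbc : b < c) {l k : Fin 3}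
    (hkl : k < l) : Compat ![a, b, c] l k := by
  have hmono := strictMono_vec hab hbc
  exact ⟨fun h => absurd h hkl.not_gt, fun _ =>
    ⟨fun i => ha.trans_le (hmono.monotone (Fin.zero_le i)), hmono⟩⟩

lemma compat_zero_one (a b : ℝ) : Compat ![a, a, b] 0 1 := by
  refine ⟨fun _ i _ hi => ?_, fun h => absurd h (by decide)⟩
  fin_cases i
  · rfl
  · rfl
  · exact absurd hi (by decide)

lemma compat_one_two (a b : ℝ) : Compat ![a, b, b] 1 2 := by
  refine ⟨fun _ i hi _ => ?_, fun h => absurd h (by decide)⟩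
  fin_cases i
  · exact absurd hi (by decide)
  · rfl
  · rfl

lemma mem_of_mem_line {p v : RVec 3} {r s t : ℝ} (hr : p + r • v ∈ C) (ht : p + t • v ∈ C)
    (hs : s ∈ Icc r t) : p + s • v ∈ C := by
  rw [← segment_eq_Icc (hs.1.trans hs.2)] at hs
  obtain ⟨a, b, ha, hb, hab, rfl⟩ := hs
  have hmem := C.convex hr ht ha hb hab
  obtain rfl : a = 1 - b := by linarith
  have : p + ((1 - b) • r + b • t) • v = (1 - b) • (p + r • v) + b • (p + t • v) := by
    simp only [smul_eq_mul]
    module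
  rwa [this]

lemma mem_third {a b r s t : ℝ} (hr : ![a, b, r] ∈ C) (ht : ![a, b, t] ∈ C) (hs : s ∈ Icc r t) :
    ![a, b, s] ∈ C := by
  have h : ∀ s : ℝ, ![a, b, s] = ![a, b, 0] + s • ![0, 0, 1] := fun s => by simp
  rw [h s]
  exact mem_of_mem_line (h r ▸ hr) (h t ▸ ht) hs

lemma mem_ray {w r s t : ℝ} (hr : ![1, r, r * w] ∈ C) (ht : ![1, t, t * w] ∈ C)
    (hs : s ∈ Icc r t) : ![1, s, s * w] ∈ C := by
  have h : ∀ s : ℝ, ![1, s, s * w] = ![1, 0, 0] + s • ![0, 1, w] := fun s => by simp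
  rw [h s]
  exact mem_of_mem_line (h r ▸ hr) (h t ▸ ht) hs

lemma reach_of_eq {y : RVec 3} {d : ℝ} (hx : x ∈ C) (hy : y ∈ C) (hd : 0 < d)
    (h : y = x + d • eVec 3 k) : Reach C ∅ k x k y := by
  subst h
  exact reach_segment hx hd hy

/-- An elementary step along the plane where the two smallest coordinates agree. -/
lemma reach_low_step {r : ℝ} (hr : 1 < r) (hθ : 1 < θ) (h1 : ![1, 1, r * θ] ∈ C)
    (h2 : ![1, θ, r * θ] ∈ C) (h3 : ![1, 1, r] ∈ C) :
    Reach C ∅ 1 ![1, 1, r * θ] 0 (θ • ![1, 1, r]) := by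
  have hd : 0 < θ - 1 := sub_pos.2 hθ
  have hs1 : Reach C ∅ 1 ![1, 1, r * θ] 1 ![1, θ, r * θ] :=
    reach_of_eq h1 h2 hd (by rw [eVec_one]; simp)
  have hs2 : Reach C ∅ 0 ![1, θ, r * θ] 0 (θ • ![1, 1, r]) :=
    reach_of_eq h2 (C.smul_mem (one_pos.trans hθ) h3) hd (by rw [eVec_zero]; simp [mul_comm])
  exact (hs1.trans hs2 (compat_of_lt one_pos hθ (by nlinarith) (by decide))).mono
    (empty_subset _)

/-- An elementary step along the plane where the two largest coordinates agree. -/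
lemma reach_high_step {s : ℝ} (hs : 1 < s) (hθ : 1 < θ) (h1 : ![1, s, s] ∈ C)
    (h2 : ![1, s, s * θ] ∈ C) (h3 : ![1, s * θ, s * θ] ∈ C) :
    Reach C ∅ 2 ![1, s, s] 1 ![1, s * θ, s * θ] := by
  have hlt : s < s * θ := by nlinarith
  have hd : 0 < s * θ - s := sub_pos.2 hlt
  have hs1 : Reach C ∅ 2 ![1, s, s] 2 ![1, s, s * θ] :=
    reach_of_eq h1 h2 hd (by rw [eVec_two]; simp)
  have hs2 : Reach C ∅ 1 ![1, s, s * θ] 1 ![1, s * θ, s * θ] :=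
    reach_of_eq h2 h3 hd (by rw [eVec_one]; simp)
  exact (hs1.trans hs2 (compat_of_lt one_pos hs hlt (by decide))).mono (empty_subset _)

lemma Reach.descend (hβ : 1 < β) (hθ : 1 < θ) (hα : ![1, 1, α] ∈ C) (hβC : ![1, 1, β] ∈ C)
    (hαθ : ![1, θ, α] ∈ C) (hβθ : ![1, θ, β * θ] ∈ C) (n : ℕ) (hn : β * θ ^ n ≤ α) (hc : 0 < c)
    (h : Reach C D k x 0 (c • ![1, 1, β * θ ^ n])) :
    ∃ c > (0 : ℝ), Reach C D k x 0 (c • ![1, 1, β]) := by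
  induction n generalizing c with
  | zero => exact ⟨c, hc, by simpa using h⟩
  | succ n ih =>
    have hp : 1 ≤ θ ^ n := one_le_pow₀ hθ.le
    have h1 : β ≤ β * θ ^ n := le_mul_of_one_le_right (by linarith) hp
    have h2 : β * θ ≤ β * θ ^ n * θ := mul_le_mul_of_nonneg_right h1 (by linarith)
    have h3 : β * θ ^ n ≤ β * θ ^ n * θ := le_mul_of_one_le_right (by linarith) hθ.le
    rw [pow_succ, ← mul_assoc] at h hn
    have hstep := reach_low_step (hβ.trans_le h1) hθ
      (mem_third hβC hα ⟨h1.trans h3, hn⟩) (mem_third hβθ hαθ ⟨h2, hn⟩)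
      (mem_third hβC hα ⟨h1, h3.trans hn⟩)
    have := h.trans (hstep.smul hc) ((compat_zero_one _ _).scale hc)
    rw [union_empty, smul_smul] at this
    exact ih (h3.trans hn) (mul_pos hc (one_pos.trans hθ)) this

lemma Reach.ascend (hβ : 1 < β) (hθ : 1 < θ) (hα : ![1, α, α] ∈ C) (hβC : ![1, β, β] ∈ C)
    (hαθ : ![1, α / θ, α] ∈ C) (hβθ : ![1, β, β * θ] ∈ C) (n : ℕ) (hn : β * θ ^ n ≤ α)
    (hc : 0 < c) (h : Reach C D k x 1 (c • ![1, β, β])) :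
    Reach C D k x 1 (c • ![1, β * θ ^ n, β * θ ^ n]) := by
  induction n with
  | zero => simpa using h
  | succ n ih =>
    have hθ0 := one_pos.trans hθ
    have hp : 1 ≤ θ ^ n := one_le_pow₀ hθ.le
    have h1 : β ≤ β * θ ^ n := le_mul_of_one_le_right (by linarith) hp
    have h3 : β * θ ^ n ≤ β * θ ^ n * θ := le_mul_of_one_le_right (by linarith) hθ.le
    rw [pow_succ, ← mul_assoc] at hn ⊢
    have hdiag : ∀ s ∈ Icc β α, ![1, s, s] ∈ C := fun s hs => by
      simpa using mem_ray (w := 1) (by simpa using hβC) (by simpa using hα) hs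
    have hstep := reach_high_step (hβ.trans_le h1) hθ (hdiag _ ⟨h1, h3.trans hn⟩)
      (mem_ray hβθ (by rwa [div_mul_cancel₀ _ hθ0.ne']) ⟨h1, (le_div_iff₀ hθ0).2 hn⟩)
      (hdiag _ ⟨h1.trans h3, hn⟩)
    have := (ih (h3.trans hn)).trans (hstep.smul hc) ((compat_one_two _ _).scale hc)
    rwa [union_empty] at this

/-- What is needed from a self-similar system in the cone `C` in order to join it to another one:
`D` is its image, and it contains a path from `(1, 1, α)` to `(1, α, α)`. -/
structure Rise (C : ConvexCone ℝ (RVec 3)) (D : Set (RVec 3)) (α : ℝ) : Prop where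
  one_lt : 1 < α
  mem : ∀ y ∈ Icc 1 α, ![1, y, α] ∈ C
  low : ∀ᶠ θ in 𝓝[>] (1 : ℝ), ![1, θ, α * θ] ∈ C
  high : ∀ᶠ θ in 𝓝[>] (1 : ℝ), ![1, α, α * θ] ∈ C
  reach_low : ∃ c > (0 : ℝ), Reach C D 2 ![1, α, α] 0 (c • ![1, 1, α])
  reach_high : ∃ c > (0 : ℝ), Reach C D 1 ![1, 1, α] 1 (c • ![1, α, α])

lemma exists_pow_eq {p : ℝ → Prop} (hp : ∀ᶠ θ in 𝓝[>] (1 : ℝ), p θ) {κ : ℝ} (hκ : 1 ≤ κ) :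
    ∃ θ > 1, p θ ∧ ∃ n : ℕ, θ ^ n = κ := by
  rcases hκ.eq_or_lt with rfl | hκ
  · obtain ⟨θ, h1, h2⟩ := (hp.and self_mem_nhdsWithin).exists
    exact ⟨θ, h2, h1, 0, pow_zero θ⟩
  · have htend : Tendsto (fun n : ℕ => κ ^ ((n + 1 : ℕ) : ℝ)⁻¹) atTop (𝓝[>] 1) := by
      refine tendsto_nhdsWithin_iff.2 ⟨?_, .of_forall fun n =>
        Real.one_lt_rpow hκ (inv_pos.2 (Nat.cast_pos.2 n.succ_pos))⟩
      have h1 : Tendsto (fun n : ℕ => ((n + 1 : ℕ) : ℝ)⁻¹) atTop (𝓝 0) :=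
        tendsto_inv_atTop_zero.comp
          (tendsto_natCast_atTop_atTop.comp (tendsto_add_atTop_nat 1))
      have h2 := (Real.continuousAt_const_rpow (one_pos.trans hκ).ne' (b := 0)).tendsto.comp h1
      simpa [Function.comp_def] using h2
    obtain ⟨n, h1, h2⟩ := ((htend.eventually hp).and
      (htend.eventually self_mem_nhdsWithin)).exists
    exact ⟨_, h2, h1, n + 1, Real.rpow_inv_natCast_pow (one_pos.trans hκ).le n.succ_ne_zero⟩

lemma Rise.exists_reach (hA : Rise C D α) (hB : Rise C D' β) (hβα : β ≤ α) :
    ∃ ρ : ℝ, Reach C (D ∪ D') 2 ![1, α, α] 1 (ρ • ![1, α, α]) := by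
  have hβ := hB.one_lt
  have hβ0 : 0 < β := one_pos.trans hβ
  obtain ⟨θ, hθ, ⟨⟨hlow, hhigh⟩, hθα⟩, n, hn⟩ := exists_pow_eq
    ((hB.low.and hB.high).and (Ioc_mem_nhdsGT hA.one_lt)) ((one_le_div hβ0).2 hβα)
  have hn' : β * θ ^ n = α := by rw [hn, mul_div_cancel₀ _ hβ0.ne']
  have hθ0 : 0 < θ := one_pos.trans hθ
  have hα1 := hA.one_lt.le
  obtain ⟨c₁, hc₁, h₁⟩ := hA.reach_low
  rw [← hn'] at h₁
  obtain ⟨c₂, hc₂, h₂⟩ := h₁.descend hβ hθ (hA.mem 1 ⟨le_rfl, hα1⟩) (hB.mem 1 ⟨le_rfl, hβ.le⟩)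
    (hA.mem θ ⟨hθ.le, hθα.2⟩) hlow n hn'.le hc₁
  obtain ⟨c₃, hc₃, h₃⟩ := hB.reach_high
  have h₄ := h₂.trans (h₃.smul hc₂) ((compat_zero_one _ _).scale hc₂)
  rw [smul_smul] at h₄
  have h₅ := h₄.ascend hβ hθ (hA.mem α ⟨hα1, le_rfl⟩) (hB.mem β ⟨hβ.le, le_rfl⟩)
    (hA.mem (α / θ) ⟨(one_le_div hθ0).2 hθα.2, div_le_self (by linarith) hθ.le⟩) hhigh n hn'.le
    (mul_pos hc₂ hc₃)
  rw [hn'] at h₅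
  exact ⟨_, h₅⟩

/-- Two systems containing rises can be joined into a single one. -/
lemma Rise.exists_isLoop (hC : ∀ x ∈ C, 0 < x 0 ∧ Monotone x) (hA : Rise C D α)
    (hB : Rise C D' β) (hβα : β ≤ α) : ∃ S a ρ, IsLoop S a ρ ∧ (∀ q > a, S q ∈ C) ∧
      (∀ d ∈ D ∪ D', ∃ q > a, ∃ c > (0 : ℝ), S q = c • d) ∧ ∃ b > a, StrictMono (S b) := by
  obtain ⟨ρ, hρ⟩ := hA.exists_reach hB hβα
  obtain ⟨S, a, hS, hSC, hSD, hR, hSa⟩ := hρ.exists_isLoop hC (compat_one_two _ _)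
  refine ⟨S, a, ρ, hS, hSC, hSD, ?_⟩
  obtain ⟨b, hb, hSb⟩ := eventually_exists_gt hR
  have : S b = ![1, α, α + (b - a)] := by
    rw [hSb, hSa, eVec_two]
    simp
  exact ⟨b, hb, this ▸ strictMono_vec hA.one_lt (by linarith)⟩

/-- A piece of a system is a path. -/
lemma IsLoop.reach {P : ℝ → RVec 3} {a ρ q r z : ℝ} (h : IsLoop P a ρ) (hPC : ∀ q > a, P q ∈ C)
    (hq : a < q) (hz : q ≤ z) (hzr : ρ * z ≤ r) {k l : Fin 3} (hk : SlopeR P q k)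
    (hl : SlopeL P r l) : Reach C (P '' Ioi a) k (P q) l (P r) := by
  have hzρ := h.lt_mul (hq.trans_le hz)
  refine ⟨P, q, r, by linarith, rfl, rfl, hk, hl, fun t ht => h.turn t (hq.trans ht.1),
    fun t ht => ⟨hPC t (hq.trans_le ht.1), (h.adm t (hq.trans_le ht.1)).2.2⟩, ?_⟩
  rintro _ ⟨t, ht, rfl⟩
  obtain ⟨c, hc, hct, hP⟩ := h.exists_scale_mem (hq.trans_le hz) ht
  exact ⟨c * t, ⟨hz.trans hct.1, hct.2.trans hzr⟩, c, hc, hP⟩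

lemma IsLoop.slopeL_mul {P : ℝ → RVec 3} {a ρ q : ℝ} (h : IsLoop P a ρ) (hq : a < q) {l : Fin 3}
    (hl : SlopeL P q l) : SlopeL P (ρ * q) l := by
  have hρ : 0 < ρ := one_pos.trans h.one_lt
  refine SlopeL.congr (SlopeL.scale (q := ρ * q) hρ (by rwa [mul_div_cancel_left₀ _ hρ.ne'])) ?_
  filter_upwards [nhdsWithin_le_nhds (Ioi_mem_nhds (mul_lt_mul_of_pos_left hq hρ))] with t ht
  rw [← h.scale _ ((lt_div_iff₀' hρ).2 ht), mul_div_cancel₀ _ hρ.ne']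

lemma mem_of_smul_eq {y : RVec 3} (hx : x ∈ C) (hc : 0 < c) (h : x = c • y) : y ∈ C := by
  have := C.smul_mem (inv_pos.2 hc) hx
  rwa [h, inv_smul_smul₀ hc.ne'] at this

lemma IsLoop.exists_rise_mem {P : ℝ → RVec 3} {a ρ : ℝ} (h : IsLoop P a ρ)
    (hPC : ∀ q > a, P q ∈ C) : ∃ α, Rise C (P '' Ioi a) α := by
  obtain ⟨q₁, q₂, u, v, ha1, h12, hu, huv, hP1, hP2, hP, hL1, hR1, hL2, hR2⟩ := h.exists_rise
  have ha2 := ha1.trans h12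
  have hq₁ : q₁ = u + u + v := by
    have := h.sum_eq ha1
    simp [hP1] at this
    exact this.symm
  have hq₂ : q₂ = u + v + v := by
    have := h.sum_eq ha2
    simp [hP2] at this
    exact this.symm
  have hα : u * (v / u) = v := mul_div_cancel₀ v hu.ne'
  have hv1 : ![u, u, v] = u • ![1, 1, v / u] := by simp [hα]
  have hv2 : ![u, v, v] = u • ![1, v / u, v / u] := by simp [hα]
  have hρ0 : 0 < ρ := one_pos.trans h.one_lt
  have hρ1 := h.lt_mul ha1
  have hρ2 := h.lt_mul ha2
  have h21 : q₂ < ρ * q₁ := by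
    by_contra! hle
    have h1 := h.scale q₁ ha1
    rw [hP _ ⟨hρ1.le, hle⟩, hP1] at h1
    have h2 : u = ρ * u := by simpa using congrFun h1 0
    nlinarith [h.one_lt]
  have ha1' := ha1.trans hρ1
  have ha2' := ha2.trans hρ2
  refine ⟨v / u, (one_lt_div hu).2 huv, fun y hy => ?_, ?_, ?_, ?_, ?_⟩
  · have hmem : u + u * y + v ∈ Icc q₁ q₂ := by
      have h1 := mul_le_mul_of_nonneg_left hy.1 hu.le
      have h2 := mul_le_mul_of_nonneg_left hy.2 hu.le
      rw [hα] at h2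
      constructor <;> linarith
    refine mem_of_smul_eq (hPC _ (ha1.trans_le hmem.1)) hu ?_
    rw [hP _ hmem]
    simp [hα]
    ring
  · have htend : Tendsto (fun θ : ℝ => q₁ - u + u / θ) (𝓝[>] 1) (𝓝[≤] q₁) := by
      refine tendsto_nhdsWithin_iff.2 ⟨?_, ?_⟩
      · have : ContinuousAt (fun θ : ℝ => q₁ - u + u / θ) 1 := by
          fun_prop (disch := norm_num)
        simpa using this.tendsto.mono_left nhdsWithin_le_nhds
      · filter_upwards [self_mem_nhdsWithin] with θ hθ
        have := div_le_self hu.le (le_of_lt hθ)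
        simp only [mem_Iic]
        linarith
    filter_upwards [htend.eventually (hL1.and (nhdsWithin_le_nhds (Ioi_mem_nhds ha1))),
      self_mem_nhdsWithin] with θ hθ hθ1
    have hθ0 : 0 < θ := one_pos.trans hθ1
    refine mem_of_smul_eq (hPC _ hθ.2) (div_pos hu hθ0) ?_
    rw [hθ.1, hP1, eVec_zero]
    ext i
    fin_cases i
    · simp
      ring
    · simp [hθ0.ne']
    · simp
      field_simp
  · have htend : Tendsto (fun θ : ℝ => q₂ + v * (θ - 1)) (𝓝[>] 1) (𝓝[≥] q₂) := by
      refine tendsto_nhdsWithin_iff.2 ⟨?_, ?_⟩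
      · have : ContinuousAt (fun θ : ℝ => q₂ + v * (θ - 1)) 1 := by fun_prop
        simpa using this.tendsto.mono_left nhdsWithin_le_nhds
      · filter_upwards [self_mem_nhdsWithin] with θ hθ
        have := mul_nonneg (hu.trans huv).le (sub_nonneg.2 (le_of_lt hθ))
        simp only [mem_Ici]
        linarith
    filter_upwards [htend.eventually (hR2.and (nhdsWithin_le_nhds (Ioi_mem_nhds ha2)))] with θ hθ
    refine mem_of_smul_eq (hPC _ hθ.2) hu ?_
    rw [hθ.1, hP2, eVec_two]
    ext i
    fin_cases i
    · simp
    · simp [hα]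
    · simp
      field_simp
      ring
  · refine ⟨ρ * ρ, mul_pos hρ0 hρ0, ?_⟩
    have := (h.reach hPC ha2 le_rfl (mul_le_mul_of_nonneg_left h21.le hρ0.le) hR2
      (h.slopeL_mul ha1' (h.slopeL_mul ha1 hL1))).smul (inv_pos.2 hu)
    rwa [h.scale _ ha1', h.scale _ ha1, hP1, hP2, hv1, hv2, inv_smul_smul₀ hu.ne',
      smul_comm u⁻¹ ρ, smul_comm u⁻¹ ρ, inv_smul_smul₀ hu.ne', smul_smul] at this
  · refine ⟨ρ, hρ0, ?_⟩
    have := (h.reach hPC ha1 le_rfl (mul_le_mul_of_nonneg_left h12.le hρ0.le) hR1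
      (h.slopeL_mul ha2 hL2)).smul (inv_pos.2 hu)
    rwa [h.scale _ ha2, hP1, hP2, hv1, hv2, inv_smul_smul₀ hu.ne',
      smul_comm u⁻¹ ρ, inv_smul_smul₀ hu.ne'] at this

end Zigzag

/-- Any two systems in the cone `C` can be joined into a single one. -/
lemma IsLoop.exists_join {C : ConvexCone ℝ (RVec 3)} (hC : ∀ x ∈ C, 0 < x 0 ∧ Monotone x)
    {P Q : ℝ → RVec 3} {a b ρ σ : ℝ} (hP : IsLoop P a ρ) (hQ : IsLoop Q b σ)
    (hPC : ∀ q > a, P q ∈ C) (hQC : ∀ q > b, Q q ∈ C) :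
    ∃ S e τ, IsLoop S e τ ∧ (∀ q > e, S q ∈ C) ∧
      (∀ d ∈ P '' Ioi a ∪ Q '' Ioi b, ∃ q > e, ∃ c > (0 : ℝ), S q = c • d) ∧
      ∃ f > e, StrictMono (S f) := by
  obtain ⟨α, hα⟩ := hP.exists_rise_mem hPC
  obtain ⟨β, hβ⟩ := hQ.exists_rise_mem hQC
  rcases le_total β α with h | h
  · exact hα.exists_isLoop hC hβ h
  · rw [union_comm]
    exact hβ.exists_isLoop hC hα h

lemma convex_normalized :
    Convex ℝ {x : RVec 3 | (0 < x 0 ∧ Monotone x) ∧ ∑ i, x i = 1} := by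
  rintro x ⟨⟨hx0, hxm⟩, hx⟩ y ⟨⟨hy0, hym⟩, hy⟩ s t hs ht hst
  refine ⟨⟨?_, fun i j hij => ?_⟩, ?_⟩
  · simp only [Pi.add_apply, Pi.smul_apply, smul_eq_mul]
    rcases hs.eq_or_lt with rfl | hs
    · obtain rfl : t = 1 := by linarith
      simpa using hy0
    · exact add_pos_of_pos_of_nonneg (mul_pos hs hx0) (mul_nonneg ht hy0.le)
  · exact add_le_add (mul_le_mul_of_nonneg_left (hxm hij) hs)
      (mul_le_mul_of_nonneg_left (hym hij) ht)
  · simp only [Pi.add_apply, Pi.smul_apply, smul_eq_mul]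
    rw [Finset.sum_add_distrib, ← Finset.mul_sum, ← Finset.mul_sum, hx, hy, mul_one, mul_one, hst]

lemma IsLoop.normalized {P : ℝ → RVec 3} {a ρ : ℝ} (h : IsLoop P a ρ) :
    (fun q => q⁻¹ • P q) '' Ioi a ⊆ {x : RVec 3 | (0 < x 0 ∧ Monotone x) ∧ ∑ i, x i = 1} := by
  rintro _ ⟨q, hq, rfl⟩
  have hq0 : 0 < q := h.pos.trans hq
  have h1 := (h.adm q hq).scale (inv_pos.2 hq0)
  exact ⟨⟨mul_pos (inv_pos.2 hq0) (h.pos_zero q hq), h1.2.1⟩,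
    h1.2.2.trans (inv_mul_cancel₀ hq0.ne')⟩

end ThreeSystem

/-- **Corollary (joining two self-similar 3-systems).** Let `S⁽¹⁾, S⁽²⁾` be
non-degenerate self-similar `3`-systems, `F = F(S⁽¹⁾) ∪ F(S⁽²⁾)` and `K` its convex
hull.  Then there is a non-degenerate self-similar `3`-system `S` with
`F ⊆ F(S) ⊆ K`; in particular `K(S) = K`. -/
theorem join_self_similar_3systems (I₁ I₂ : Set ℝ) (S₁ S₂ : ℝ → RVec 3)
    (h₁ : IsNonDegenerate 3 I₁ S₁) (h₁s : IsSelfSimilar 3 I₁ S₁)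
    (h₂ : IsNonDegenerate 3 I₂ S₂) (h₂s : IsSelfSimilar 3 I₂ S₂) :
    ∃ (J : Set ℝ) (S : ℝ → RVec 3),
      IsNonDegenerate 3 J S ∧ IsSelfSimilar 3 J S ∧
      FSet 3 I₁ S₁ ∪ FSet 3 I₂ S₂ ⊆ FSet 3 J S ∧
      FSet 3 J S ⊆ convexHull ℝ (FSet 3 I₁ S₁ ∪ FSet 3 I₂ S₂) ∧
      convexHull ℝ (FSet 3 J S) = convexHull ℝ (FSet 3 I₁ S₁ ∪ FSet 3 I₂ S₂) := by
  obtain ⟨a, ρ, rfl, hA⟩ := ThreeSystem.exists_isLoop h₁ h₁s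
  obtain ⟨b, σ, rfl, hB⟩ := ThreeSystem.exists_isLoop h₂ h₂s
  rw [hA.fSet_eq, hB.fSet_eq]
  set F := (fun q => q⁻¹ • S₁ q) '' Ioi a ∪ (fun q => q⁻¹ • S₂ q) '' Ioi b
  have hK := convexHull_min (union_subset hA.normalized hB.normalized)
    ThreeSystem.convex_normalized
  have hmem : ∀ x, x ∈ ConvexCone.hull ℝ (convexHull ℝ F) ↔
      ∃ r : ℝ, 0 < r ∧ x ∈ r • convexHull ℝ F :=
    fun x => ConvexCone.mem_hull_of_convex (convex_convexHull ℝ F)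
  have hC : ∀ x ∈ ConvexCone.hull ℝ (convexHull ℝ F), 0 < x 0 ∧ Monotone x := by
    intro x hx
    obtain ⟨r, hr, y, hy, rfl⟩ := (hmem x).1 hx
    have hy' := (hK hy).1
    exact ⟨mul_pos hr hy'.1, fun i j hij => mul_le_mul_of_nonneg_left (hy'.2 hij) hr.le⟩
  have hcone : ∀ (P : ℝ → RVec 3) (q : ℝ), 0 < q → q⁻¹ • P q ∈ F →
      P q ∈ ConvexCone.hull ℝ (convexHull ℝ F) := fun P q hq hP =>
    (hmem _).2 ⟨q, hq, q⁻¹ • P q, subset_convexHull ℝ F hP, smul_inv_smul₀ hq.ne' _⟩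
  obtain ⟨S, e, τ, hS, hSC, hSD, f, hf, hSf⟩ := hA.exists_join hC hB
    (fun q hq => hcone S₁ q (hA.pos.trans hq) (Or.inl ⟨q, hq, rfl⟩))
    (fun q hq => hcone S₂ q (hB.pos.trans hq) (Or.inr ⟨q, hq, rfl⟩))
  have hcover : ∀ (P : ℝ → RVec 3) (q : ℝ), 0 < q → ∑ i, P q i = q →
      P q ∈ S₁ '' Ioi a ∪ S₂ '' Ioi b → q⁻¹ • P q ∈ (fun q => q⁻¹ • S q) '' Ioi e := by
    intro P q hq hsum hP
    obtain ⟨t, ht, c, hc, hSt⟩ := hSD _ hP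
    refine ⟨t, ht, ?_⟩
    have htc : t = c * q := by
      rw [← (hS.adm t ht).2.2, ← hsum, hSt, Finset.mul_sum]
      rfl
    change t⁻¹ • S t = q⁻¹ • P q
    rw [hSt, htc, smul_smul, mul_inv, mul_right_comm, inv_mul_cancel₀ hc.ne', one_mul]
  have h1 : F ⊆ FSet 3 (Ici f) S := by
    rw [hS.fSet_eq]
    rintro _ (⟨q, hq, rfl⟩ | ⟨q, hq, rfl⟩)
    · exact hcover S₁ q (hA.pos.trans hq) (hA.adm q hq).2.2 (Or.inl ⟨q, hq, rfl⟩)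
    · exact hcover S₂ q (hB.pos.trans hq) (hB.adm q hq).2.2 (Or.inr ⟨q, hq, rfl⟩)
  have h2 : FSet 3 (Ici f) S ⊆ convexHull ℝ F := by
    rw [hS.fSet_eq]
    rintro _ ⟨q, hq, rfl⟩
    obtain ⟨r, hr, y, hy, hry⟩ := (hmem _).1 (hSC q hq)
    have hrq : r = q := by
      have h3 := (hS.adm q hq).2.2
      rw [← hry] at h3
      simp only [Pi.smul_apply, smul_eq_mul] at h3
      rwa [← Finset.mul_sum, (hK hy).2, mul_one] at h3
    subst hrq
    simp only [← hry, inv_smul_smul₀ hr.ne']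
    exact hy
  obtain ⟨hnd, hss⟩ := hS.isNonDegenerate hf hSf
  exact ⟨Ici f, S, hnd, hss, h1, h2,
    Subset.antisymm (convexHull_min h2 (convex_convexHull ℝ F)) (convexHull_mono h1)⟩
end
end
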